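/- arXiv:math/9807062 — 3 statements merged into one kernel-verified Lean document; each statement's English description precedes it below -/
import Mathlib

section
/- (i) For every a ∈ K the functional x ↦ ⟨a,x⟩ : K̄ → k is k-linear and continuous, and every continuous k-linear functional on K̄ is of this form for a unique a ∈ K. (ii) For every y ∈ K̄ the functional a ↦ ⟨a,y⟩ : K → k is k-linear and continuous (K carrying the inductive limit topology, i.e. the finest locally convex topology over k making all inclusions K_n → K continuous), and every continuous k-linear functional on K is of this form for a unique y ∈ K̄. (iii) K, viewed as a subset of K̄ via the embedding x ↦ (T₁(x), T₂(x), …), is dense in K̄. -/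
open MeasureTheory Module
open scoped Classical

noncomputable section

/-- The topology defined by a translation-invariant "norm" function via open balls. -/
def normTopology {X : Type} [Sub X] (f : X → ℝ) : TopologicalSpace X :=
  TopologicalSpace.generateFrom
    {U | ∃ x : X, ∃ ε : ℝ, 0 < ε ∧ U = {y : X | f (y - x) < ε}}

variable (p : ℕ) [Fact (Nat.Prime p)]
variable (k : Type) [Field k] [Algebra ℚ_[p] k] [FiniteDimensional ℚ_[p] k]

/-- The normalized absolute value on the local field k. -/
def absk (x : k) : ℝ := ‖(Algebra.norm ℚ_[p] x : ℚ_[p])‖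

/-- The topology of k as a local field. -/
def kTop : TopologicalSpace k := normTopology (absk p k)

variable (K : Type) [Field K] [Algebra k K] [CharZero K]
variable (Kn : ℕ → IntermediateField k K)

/-- The relative trace map between two intermediate fields. -/
def relTrace (E F : IntermediateField k K) (h : E ≤ F) (x : F) : E :=
  (@Algebra.trace E F _ _ (IntermediateField.inclusion h).toRingHom.toAlgebra) x

variable (T : ℕ → K →ₗ[k] K)

/-- The projective limit K̄ of the fields Kₙ along the normalized trace maps. -/
def ProjLim : Type :=
  {x : ℕ → K // (∀ n, x n ∈ Kn n) ∧ ∀ ⦃n ν : ℕ⦄, n ≤ ν → T n (x ν) = x n}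

/-- Pointwise addition on K̄. -/
def pladd (x y : ProjLim k K Kn T) : ProjLim k K Kn T :=
  ⟨fun n => x.1 n + y.1 n, by
    refine ⟨fun n => add_mem (x.2.1 n) (y.2.1 n), ?_⟩
    intro n ν h
    simp [map_add, x.2.2 h, y.2.2 h]⟩

/-- Pointwise scalar multiplication on K̄. -/
def plsmul (c : k) (x : ProjLim k K Kn T) : ProjLim k K Kn T :=
  ⟨fun n => c • x.1 n, by
    refine ⟨fun n => (Kn n).toSubalgebra.smul_mem (x.2.1 n) c, ?_⟩
    intro n ν h
    simp [_root_.map_smul, x.2.2 h]⟩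

/-- The topology on K̄ given by the seminorms x ↦ ‖xₙ‖. -/
def projTop (Knorm : K → ℝ) : TopologicalSpace (ProjLim k K Kn T) :=
  TopologicalSpace.generateFrom
    {U | ∃ x : ProjLim k K Kn T, ∃ n : ℕ, ∃ ε : ℝ, 0 < ε ∧
          U = {y : ProjLim k K Kn T | Knorm (y.1 n - x.1 n) < ε}}

/-- The Borel σ-algebra of the seminorm topology on K̄. -/
def projMeas (Knorm : K → ℝ) : MeasurableSpace (ProjLim k K Kn T) :=
  @borel _ (projTop k K Kn T Knorm)

/-- The topology on Kₙ induced from the absolute value ‖·‖. -/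
def KnTop (Knorm : K → ℝ) (n : ℕ) : TopologicalSpace (Kn n) :=
  TopologicalSpace.induced Subtype.val (normTopology Knorm)

/-- The Borel σ-algebra of Kₙ. -/
def KnMeas (Knorm : K → ℝ) (n : ℕ) : MeasurableSpace (Kn n) :=
  @borel _ (KnTop k K Kn Knorm n)

/-- The canonical embedding of K into K̄. -/
def emb (hTmem : ∀ n x, T n x ∈ Kn n)
    (hTproj : ∀ ⦃n ν : ℕ⦄, n ≤ ν → ∀ x : K, T n (T ν x) = T n x) (x : K) :
    ProjLim k K Kn T :=
  ⟨fun n => T n x, fun n => hTmem n x, fun n ν h => hTproj h x⟩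

/-- The weak topology σ(K̄, K) on K̄. -/
def weakTop (pairing : K → ProjLim k K Kn T → k) : TopologicalSpace (ProjLim k K Kn T) :=
  ⨅ a : K, TopologicalSpace.induced (pairing a) (kTop p k)

/-- Non-archimedean seminorms on K over k. -/
def IsNASeminorm (f : K → ℝ) : Prop :=
  (∀ x, 0 ≤ f x) ∧ (∀ x y, f (x + y) ≤ max (f x) (f y)) ∧
    ∀ (c : k) (x : K), f (c • x) = absk p k c * f x

/-- The locally convex topology determined by a family of seminorms. -/
def seminormFamilyTop (F : Set (K → ℝ)) : TopologicalSpace K :=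
  TopologicalSpace.generateFrom
    {U | ∃ f ∈ F, ∃ x : K, ∃ ε : ℝ, 0 < ε ∧ U = {y : K | f (y - x) < ε}}

/-- The inductive limit topology on K: the finest locally convex topology over k
making all the inclusions Kₙ → K continuous. -/
def indTop (Knorm : K → ℝ) : TopologicalSpace K :=
  sInf {t : TopologicalSpace K |
    (∃ F : Set (K → ℝ), (∀ f ∈ F, IsNASeminorm p k K f) ∧ t = seminormFamilyTop K F) ∧
    ∀ n : ℕ, @Continuous _ _ (KnTop k K Kn Knorm n) t Subtype.val}

/-- Locally constant functions with bounded (hence compact) support on Kₙ. -/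
def IsTestFun (Knorm : K → ℝ) (n : ℕ) (φ : Kn n → ℂ) : Prop :=
  @IsLocallyConstant _ _ (KnTop k K Kn Knorm n) φ ∧
    ∃ R : ℝ, ∀ ξ : Kn n, R < Knorm ↑ξ → φ ξ = 0


/-- The fractional differentiation operator Dᵅ applied to the cylindrical function φ ∘ Tₙ. -/
def Dop (Knorm : K → ℝ) (χ : k → ℂ) (pairing : K → ProjLim k K Kn T → k)
    (vol : ∀ n : ℕ, @MeasureTheory.Measure (Kn n) (KnMeas k K Kn Knorm n))
    (μ : @MeasureTheory.Measure (ProjLim k K Kn T) (projMeas k K Kn T Knorm))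
    (α : ℝ) (n : ℕ) (φ : Kn n → ℂ) (x : ProjLim k K Kn T) : ℂ :=
  ∫ ξ : Kn n,
    χ ((finrank k (Kn n) : k)⁻¹ *
        Algebra.trace k (Kn n) (-(⟨x.1 n, x.2.1 n⟩ * ξ))) *
      (if 1 < Knorm ↑ξ then ((Knorm ↑ξ ^ α : ℝ) : ℂ) else 0) *
      (∫ y, χ (pairing (↑ξ) y) * φ ⟨y.1 n, y.2.1 n⟩ ∂μ) ∂(vol n)
end

theorem norm_algebraNorm_eq_spectralNorm_pow {F L : Type*} [NontriviallyNormedField F]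
    [IsUltrametricDist F] [CompleteSpace F] [CharZero F] [Field L] [Algebra F L]
    [FiniteDimensional F L] (x : L) :
    ‖Algebra.norm F x‖ = spectralNorm F L x ^ finrank F L := by
  rw [← spectralNorm_extends (L := AlgebraicClosure F), Algebra.norm_eq_prod_embeddings,
    ← spectralMulAlgNorm_def, map_prod, ← AlgHom.card F L (AlgebraicClosure F),
    ← Finset.card_univ, ← Finset.prod_const]
  refine Finset.prod_congr rfl fun σ _ ↦ ?_
  rw [spectralMulAlgNorm_def, spectralNorm, spectralNorm, minpoly.algHom_eq σ σ.injective]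

section absk

variable (p : ℕ) [Fact (Nat.Prime p)]
variable (k : Type) [Field k] [Algebra ℚ_[p] k]

theorem absk_nonneg (x : k) : 0 ≤ absk p k x := norm_nonneg _

theorem absk_mul (x y : k) : absk p k (x * y) = absk p k x * absk p k y := by
  simp [absk]

theorem eq_zero_of_absk_mul_lt_one {x : k} (h : ∀ c : k, absk p k (c * x) < 1) : x = 0 := by
  by_contra hx
  have := h x⁻¹
  rw [inv_mul_cancel₀ hx] at this
  simp [absk] at this

variable [FiniteDimensional ℚ_[p] k]

theorem absk_zero : absk p k 0 = 0 := by
  simp [absk]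

theorem absk_add_le (x y : k) : absk p k (x + y) ≤ max (absk p k x) (absk p k y) := by
  have h : spectralNorm ℚ_[p] k (x + y) ≤ _ := isNonarchimedean_spectralNorm x y
  simp only [absk, norm_algebraNorm_eq_spectralNorm_pow]
  have h' := pow_le_pow_left₀ (spectralNorm_nonneg _) h (finrank ℚ_[p] k)
  rcases le_total (spectralNorm ℚ_[p] k x) (spectralNorm ℚ_[p] k y) with hxy | hxy
  · rw [max_eq_right hxy] at h'
    exact h'.trans (le_max_right _ _)
  · rw [max_eq_left hxy] at h'
    exact h'.trans (le_max_left _ _)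

/-- A `k`-linear functional on a finite extension of `k` is bounded for the normalized
absolute values. -/
theorem exists_absk_le_mul {F : Type} [Field F] [Algebra k F] [FiniteDimensional k F]
    (l : F →ₗ[k] k) : ∃ C : ℝ, 0 < C ∧ ∀ z : F,
      absk p k (l z) ≤ C * absk p k (Algebra.norm k z) ^ ((finrank k F : ℝ)⁻¹) := by
  let : Algebra ℚ_[p] F := ((algebraMap k F).comp (algebraMap ℚ_[p] k)).toAlgebra
  have : IsScalarTower ℚ_[p] k F := IsScalarTower.of_algebraMap_eq fun _ ↦ rfl
  have : FiniteDimensional ℚ_[p] F := FiniteDimensional.trans ℚ_[p] k F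
  let := spectralNorm.normedField ℚ_[p] k
  let : NormedSpace ℚ_[p] k := spectralNorm.normedSpace ℚ_[p] k
  let := spectralNorm.normedField ℚ_[p] F
  let : NormedSpace ℚ_[p] F := spectralNorm.normedSpace ℚ_[p] F
  obtain ⟨C, hC, hl⟩ := (l.restrictScalars ℚ_[p]).toContinuousLinearMap.bound
  refine ⟨C ^ finrank ℚ_[p] k, pow_pos hC _, fun z ↦ ?_⟩
  have hm : (finrank k F : ℝ) ≠ 0 := Nat.cast_ne_zero.2 finrank_pos.ne'
  have hz : spectralNorm ℚ_[p] k (l z) ≤ C * spectralNorm ℚ_[p] F z := hl z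
  have h0 : 0 ≤ spectralNorm ℚ_[p] F z := spectralNorm_nonneg _
  rw [absk, absk, Algebra.norm_norm, norm_algebraNorm_eq_spectralNorm_pow,
    norm_algebraNorm_eq_spectralNorm_pow, ← finrank_mul_finrank ℚ_[p] k F, pow_mul,
    ← Real.rpow_natCast (_ ^ _) (finrank k F), ← Real.rpow_mul (pow_nonneg h0 _),
    mul_inv_cancel₀ hm, Real.rpow_one, ← mul_pow]
  exact pow_le_pow_left₀ (spectralNorm_nonneg _) hz _

theorem isOpen_setOf_absk_sub_lt {X : Type} (t : TopologicalSpace X) {g : X → k}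
    (h : ∀ x, ∀ ε > 0, ∃ U, @IsOpen _ t U ∧ x ∈ U ∧ ∀ y ∈ U, absk p k (g y - g x) < ε)
    (c : k) (ε : ℝ) (hε : 0 < ε) : @IsOpen _ t {x | absk p k (g x - c) < ε} := by
  refine (@isOpen_iff_forall_mem_open X t _).2 fun x hx ↦ ?_
  obtain ⟨U, hU, hxU, hg⟩ := h x ε hε
  refine ⟨U, fun y hy ↦ ?_, hU, hxU⟩
  have := absk_add_le p k (g y - g x) (g x - c)
  rw [sub_add_sub_cancel] at this
  exact this.trans_lt (max_lt (hg y hy) hx)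

theorem continuous_kTop {X : Type} (t : TopologicalSpace X) {g : X → k}
    (h : ∀ x, ∀ ε > 0, ∃ U, @IsOpen _ t U ∧ x ∈ U ∧ ∀ y ∈ U, absk p k (g y - g x) < ε) :
    @Continuous _ _ t (kTop p k) g := by
  refine continuous_generateFrom_iff.2 ?_
  rintro _ ⟨c, ε, hε, rfl⟩
  exact isOpen_setOf_absk_sub_lt p k t h c ε hε

end absk

theorem exists_forall_trace_mul_eq {k F : Type*} [Field k] [Field F] [Algebra k F]
    [FiniteDimensional k F] [Algebra.IsSeparable k F] (l : F →ₗ[k] k) :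
    ∃ y : F, ∀ a : F, Algebra.trace k F (a * y) = l a := by
  refine ⟨((Algebra.traceForm k F).toDual (traceForm_nondegenerate k F)).symm l, fun a ↦ ?_⟩
  rw [mul_comm, ← Algebra.traceForm_apply]
  exact LinearMap.BilinForm.apply_toDual_symm_apply (hB := traceForm_nondegenerate k F) l a

theorem eq_of_forall_trace_mul_eq {k F : Type*} [Field k] [Field F] [Algebra k F]
    [FiniteDimensional k F] [Algebra.IsSeparable k F] {x y : F}
    (h : ∀ a : F, Algebra.trace k F (a * x) = Algebra.trace k F (a * y)) : x = y := by
  rw [← sub_eq_zero]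
  refine (traceForm_nondegenerate k F).2 _ fun a ↦ ?_
  rw [Algebra.traceForm_apply, mul_sub, map_sub, h, sub_self]

theorem exists_pos_absk_trace_mul_sub_lt (p : ℕ) [Fact (Nat.Prime p)] (k : Type) [Field k]
    [Algebra ℚ_[p] k] [FiniteDimensional ℚ_[p] k] {F : Type} [Field F] [Algebra k F]
    [FiniteDimensional k F] (c : k) (a : F) {ε : ℝ} (hε : 0 < ε) :
    ∃ δ > 0, ∀ z w : F, absk p k (Algebra.norm k (z - w)) ^ ((finrank k F : ℝ)⁻¹) < δ →
      absk p k (c * Algebra.trace k F (a * z) - c * Algebra.trace k F (a * w)) < ε := by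
  obtain ⟨C, hC, h⟩ := exists_absk_le_mul p k
    (c • (Algebra.trace k F).comp (LinearMap.mulLeft k a))
  refine ⟨ε / C, div_pos hε hC, fun z w hzw ↦ ?_⟩
  have hl := h (z - w)
  simp only [LinearMap.smul_apply, LinearMap.comp_apply, LinearMap.mulLeft_apply, smul_eq_mul,
    map_sub] at hl
  refine hl.trans_lt ?_
  rwa [mul_comm, ← lt_div_iff₀ hC]

theorem trace_mul_relTrace {k K : Type} [Field k] [Field K] [Algebra k K]
    {E F : IntermediateField k K} (h : E ≤ F) [FiniteDimensional k F] (a : E) (x : F) :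
    Algebra.trace k E (a * relTrace k K E F h x) =
      Algebra.trace k F (IntermediateField.inclusion h a * x) := by
  let : Algebra E F := (IntermediateField.inclusion h).toRingHom.toAlgebra
  have : IsScalarTower k E F := IsScalarTower.of_algebraMap_eq fun _ ↦ rfl
  have : FiniteDimensional E F := FiniteDimensional.right k E F
  have : FiniteDimensional k E := FiniteDimensional.left k E F
  rw [← Algebra.trace_trace (S := E) (IntermediateField.inclusion h a * x)]
  congr 1
  have := (Algebra.trace E F).map_smul a x
  rw [Algebra.smul_def, smul_eq_mul] at this
  exact this.symm

theorem exists_forall_eq_imp_mem_of_isOpen_projTop {k K : Type} [Field k] [Field K] [Algebra k K]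
    [CharZero K] {Kn : ℕ → IntermediateField k K} {T : ℕ → K →ₗ[k] K} {Knorm : K → ℝ}
    {U : Set (ProjLim k K Kn T)} (hU : @IsOpen _ (projTop k K Kn T Knorm) U)
    {x : ProjLim k K Kn T} (hx : x ∈ U) :
    ∃ N, ∀ y : ProjLim k K Kn T, y.1 N = x.1 N → y ∈ U := by
  induction hU with
  | basic V hV =>
    obtain ⟨z, n, ε, -, rfl⟩ := hV
    exact ⟨n, fun y hy ↦ by rwa [Set.mem_ofPred_eq, hy]⟩
  | univ => exact ⟨0, fun _ _ ↦ trivial⟩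
  | inter V W _ _ hV hW =>
    obtain ⟨M, hM⟩ := hV hx.1
    obtain ⟨N, hN⟩ := hW hx.2
    have hle {m n : ℕ} (h : m ≤ n) (y : ProjLim k K Kn T) (hy : y.1 n = x.1 n) :
        y.1 m = x.1 m := by rw [← y.2.2 h, hy, x.2.2 h]
    exact ⟨max M N, fun y hy ↦
      ⟨hM y (hle (le_max_left _ _) y hy), hN y (hle (le_max_right _ _) y hy)⟩⟩
  | sUnion S _ ih =>
    obtain ⟨V, hV, hxV⟩ := hx
    obtain ⟨N, hN⟩ := ih V hV hxV
    exact ⟨N, fun y hy ↦ ⟨V, hV, hN y hy⟩⟩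

theorem statement_1
    (p : ℕ) [Fact (Nat.Prime p)]
    (k : Type) [Field k] [Algebra ℚ_[p] k] [FiniteDimensional ℚ_[p] k]
    (K : Type) [Field K] [Algebra k K] [CharZero K]
    (Kn : ℕ → IntermediateField k K)
    (hbot : Kn 1 = ⊥) (hmono : Monotone Kn)
    [hfd : ∀ n, FiniteDimensional k (Kn n)]
    (hunion : ∀ x : K, ∃ n, x ∈ Kn n)
    (T : ℕ → K →ₗ[k] K)
    (hTmem : ∀ (n : ℕ) (x : K), T n x ∈ Kn n)
    (hTdef : ∀ (n ν : ℕ) (h : n ≤ ν) (x : K) (hx : x ∈ Kn ν),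
      T n x = ((finrank k (Kn n) : K) / (finrank k (Kn ν) : K)) *
        (relTrace k K (Kn n) (Kn ν) (hmono h) ⟨x, hx⟩ : K))
    (Knorm : K → ℝ)
    (hKnorm : ∀ (n : ℕ) (x : K) (hx : x ∈ Kn n),
      Knorm x = absk p k (Algebra.norm k (⟨x, hx⟩ : Kn n)) ^ ((finrank k (Kn n) : ℝ)⁻¹))
    (pairing : K → ProjLim k K Kn T → k)
    (hpair : ∀ (n : ℕ) (a : K) (ha : a ∈ Kn n) (x : ProjLim k K Kn T),
      pairing a x = (finrank k (Kn n) : k)⁻¹ *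
        Algebra.trace k (Kn n) (⟨a * x.1 n, mul_mem ha (x.2.1 n)⟩ : Kn n))
    (hTproj : ∀ ⦃n ν : ℕ⦄, n ≤ ν → ∀ x : K, T n (T ν x) = T n x) :
    (∀ a : K,
      (∀ x y : ProjLim k K Kn T,
        pairing a (pladd k K Kn T x y) = pairing a x + pairing a y) ∧
      (∀ (c : k) (x : ProjLim k K Kn T),
        pairing a (plsmul k K Kn T c x) = c * pairing a x) ∧
      @Continuous _ _ (projTop k K Kn T Knorm) (kTop p k) (pairing a)) ∧
    (∀ φ : ProjLim k K Kn T → k,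
      ((∀ x y, φ (pladd k K Kn T x y) = φ x + φ y) ∧
       (∀ (c : k) (x : ProjLim k K Kn T), φ (plsmul k K Kn T c x) = c * φ x) ∧
       @Continuous _ _ (projTop k K Kn T Knorm) (kTop p k) φ) →
      ∃! a : K, ∀ x, φ x = pairing a x) ∧
    (∀ y : ProjLim k K Kn T,
      IsLinearMap k (fun a : K => pairing a y) ∧
      @Continuous _ _ (indTop p k K Kn Knorm) (kTop p k) (fun a : K => pairing a y)) ∧
    (∀ ψ : K → k,
      (IsLinearMap k ψ ∧ @Continuous _ _ (indTop p k K Kn Knorm) (kTop p k) ψ) →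
      ∃! y : ProjLim k K Kn T, ∀ a : K, ψ a = pairing a y) ∧
    @Dense _ (projTop k K Kn T Knorm) (Set.range (emb k K Kn T hTmem hTproj)) := by
  have hk0 : CharZero k := charZero_of_injective_algebraMap (algebraMap ℚ_[p] k).injective
  have hm (n : ℕ) : (finrank k (Kn n) : k) ≠ 0 := Nat.cast_ne_zero.2 finrank_pos.ne'
  have hKnorm_zero : Knorm 0 = 0 := by
    rw [hKnorm 1 0 (zero_mem _),
      show (⟨0, zero_mem _⟩ : Kn 1) = 0 from rfl, Algebra.norm_zero, absk_zero,
      Real.zero_rpow (inv_ne_zero (Nat.cast_ne_zero.2 finrank_pos.ne'))]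
  have hballs (n : ℕ) (a : Kn n) (ε : ℝ) (hε : 0 < ε) :
      ∃ δ > 0, ∀ z w : Kn n, Knorm ((z : K) - w) < δ →
        absk p k ((finrank k (Kn n) : k)⁻¹ * Algebra.trace k (Kn n) (a * z) -
          (finrank k (Kn n) : k)⁻¹ * Algebra.trace k (Kn n) (a * w)) < ε := by
    obtain ⟨δ, hδ, h⟩ :=
      exists_pos_absk_trace_mul_sub_lt p k (finrank k (Kn n) : k)⁻¹ a hε
    refine ⟨δ, hδ, fun z w hzw ↦ h z w ?_⟩
    rwa [hKnorm n _ (sub_mem z.2 w.2)] at hzw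
  have hTtrace (n ν : ℕ) (h : n ≤ ν) (a : Kn n) (x : Kn ν) :
      (finrank k (Kn n) : k)⁻¹ * Algebra.trace k (Kn n) (a * ⟨T n x, hTmem n x⟩) =
      (finrank k (Kn ν) : k)⁻¹ * Algebra.trace k (Kn ν)
        (IntermediateField.inclusion (hmono h) a * x) := by
    have hT : (⟨T n x, hTmem n x⟩ : Kn n) = ((finrank k (Kn n) : k) / (finrank k (Kn ν) : k)) •
        relTrace k K (Kn n) (Kn ν) (hmono h) x := by
      ext
      simp [hTdef n ν h x x.2, Algebra.smul_def]
    rw [hT, mul_smul_comm, map_smul, trace_mul_relTrace, smul_eq_mul]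
    field_simp [hm n, hm ν]
  have hTid (n : ℕ) (z : K) (hz : z ∈ Kn n) : T n z = z := by
    refine congrArg Subtype.val (?_ : (⟨T n z, hTmem n z⟩ : Kn n) = ⟨z, hz⟩)
    refine eq_of_forall_trace_mul_eq (k := k) fun a ↦ ?_
    exact mul_left_cancel₀ (inv_ne_zero (hm n)) (hTtrace n n le_rfl a ⟨z, hz⟩)
  have hpair_add_left (a b : K) (y : ProjLim k K Kn T) :
      pairing (a + b) y = pairing a y + pairing b y := by
    obtain ⟨m, ha⟩ := hunion a
    obtain ⟨n, hb⟩ := hunion b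
    replace ha := hmono (le_max_left m n) ha
    replace hb := hmono (le_max_right m n) hb
    rw [hpair _ a ha, hpair _ b hb, hpair _ (a + b) (add_mem ha hb), ← mul_add, ← map_add]
    congr 2
    ext
    exact add_mul _ _ _
  have hpair_smul_left (c : k) (a : K) (y : ProjLim k K Kn T) :
      pairing (c • a) y = c * pairing a y := by
    obtain ⟨n, ha⟩ := hunion a
    have hca : c • a ∈ Kn n := (Kn n).toSubalgebra.smul_mem ha c
    rw [hpair n a ha, hpair n (c • a) hca, mul_left_comm, ← smul_eq_mul c, ← map_smul]
    congr 2
    ext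
    exact smul_mul_assoc _ _ _
  have hpair_add_right (a : K) (x y : ProjLim k K Kn T) :
      pairing a (pladd k K Kn T x y) = pairing a x + pairing a y := by
    obtain ⟨n, ha⟩ := hunion a
    rw [hpair n a ha, hpair n a ha, hpair n a ha, ← mul_add, ← map_add]
    congr 2
    ext
    exact mul_add _ _ _
  have hpair_smul_right (c : k) (a : K) (y : ProjLim k K Kn T) :
      pairing a (plsmul k K Kn T c y) = c * pairing a y := by
    obtain ⟨n, ha⟩ := hunion a
    rw [hpair n a ha, hpair n a ha, mul_left_comm, ← smul_eq_mul c, ← map_smul]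
    congr 2
    ext
    exact mul_smul_comm _ _ _
  have hpair_emb (n : ℕ) (a z : Kn n) : pairing a (emb k K Kn T hTmem hTproj z) =
      (finrank k (Kn n) : k)⁻¹ * Algebra.trace k (Kn n) (a * z) := by
    rw [hpair n a a.2]
    congr 2
    ext
    exact congrArg (fun t : K ↦ (a : K) * t) (hTid n z z.2)
  have hmem_pair (n : ℕ) (y : ProjLim k K Kn T) (a : Kn n) : pairing a y =
      (finrank k (Kn n) : k)⁻¹ * Algebra.trace k (Kn n) (a * ⟨y.1 n, y.2.1 n⟩) :=
    hpair n a a.2 y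
  refine ⟨fun a ↦ ⟨hpair_add_right a, fun c x ↦ hpair_smul_right c a x, ?_⟩, ?_,
    fun y ↦ ⟨⟨fun a b ↦ hpair_add_left a b y, fun c a ↦ hpair_smul_left c a y⟩, ?_⟩, ?_, ?_⟩
  · obtain ⟨n, ha⟩ := hunion a
    refine continuous_kTop p k _ fun x ε hε ↦ ?_
    obtain ⟨δ, hδ, h⟩ := hballs n ⟨a, ha⟩ ε hε
    refine ⟨{y | Knorm (y.1 n - x.1 n) < δ},
      TopologicalSpace.isOpen_generateFrom_of_mem ⟨x, n, δ, hδ, rfl⟩, ?_, fun y hy ↦ ?_⟩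
    · rwa [Set.mem_ofPred_eq, sub_self, hKnorm_zero]
    · rw [hmem_pair n y ⟨a, ha⟩, hmem_pair n x ⟨a, ha⟩]
      exact h ⟨y.1 n, y.2.1 n⟩ ⟨x.1 n, x.2.1 n⟩ hy
  · rintro φ ⟨hadd, hsmul, hcont⟩
    have hopen : @IsOpen _ (projTop k K Kn T Knorm) (φ ⁻¹' {c | absk p k (c - 0) < 1}) :=
      continuous_generateFrom_iff.1 hcont _ ⟨0, 1, one_pos, rfl⟩
    have hφ0 : φ (emb k K Kn T hTmem hTproj 0) = 0 := by
      have h := hsmul 0 (emb k K Kn T hTmem hTproj 0)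
      rw [zero_mul] at h
      rw [← h]
      congr 1
      refine Subtype.ext (funext fun n ↦ ?_)
      simp [emb, plsmul]
    obtain ⟨N, hN⟩ := exists_forall_eq_imp_mem_of_isOpen_projTop hopen
      (x := emb k K Kn T hTmem hTproj 0) (by simp [hφ0, absk_zero])
    have hker (y : ProjLim k K Kn T) (hy : y.1 N = 0) : φ y = 0 := by
      refine eq_zero_of_absk_mul_lt_one p k fun c ↦ ?_
      have := hN (plsmul k K Kn T c y) (by simp [plsmul, emb, hy])
      rwa [Set.mem_preimage, Set.mem_ofPred_eq, sub_zero, hsmul] at this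
    let l : Kn N →ₗ[k] k :=
      { toFun := fun z ↦ φ (emb k K Kn T hTmem hTproj z)
        map_add' := fun x y ↦ by
          rw [← hadd]
          congr 1
          exact Subtype.ext (funext fun n ↦ map_add (T n) _ _)
        map_smul' := fun c x ↦ by
          rw [RingHom.id_apply, smul_eq_mul, ← hsmul]
          congr 1
          exact Subtype.ext (funext fun n ↦ map_smul (T n) _ _) }
    have hφl (x : ProjLim k K Kn T) : φ x = l ⟨x.1 N, x.2.1 N⟩ := by
      have hsub := hker (pladd k K Kn T x
        (plsmul k K Kn T (-1) (emb k K Kn T hTmem hTproj (x.1 N))))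
        (by simp [pladd, plsmul, emb, hTid N _ (x.2.1 N)])
      rw [hadd, hsmul, neg_one_mul, ← sub_eq_add_neg, sub_eq_zero] at hsub
      exact hsub
    obtain ⟨b, hb⟩ := exists_forall_trace_mul_eq ((finrank k (Kn N) : k) • l)
    have hφb (x : ProjLim k K Kn T) : φ x = pairing b x := by
      rw [hφl, hmem_pair, mul_comm b, hb, LinearMap.smul_apply, smul_eq_mul,
        inv_mul_cancel_left₀ (hm N)]
    refine ⟨b, hφb, fun a ha ↦ ?_⟩
    · obtain ⟨M, haM⟩ := hunion a
      have haL := hmono (le_max_left M N) haM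
      have hbL := hmono (le_max_right M N) b.2
      refine congrArg Subtype.val (?_ : (⟨a, haL⟩ : Kn (max M N)) = ⟨b, hbL⟩)
      refine eq_of_forall_trace_mul_eq (k := k) fun z ↦ ?_
      refine mul_left_cancel₀ (inv_ne_zero (hm (max M N))) ?_
      rw [mul_comm z, mul_comm z, ← hpair_emb, ← hpair_emb, ← ha, hφb]
  · have hf : IsNASeminorm p k K fun a ↦ absk p k (pairing a y) := by
      refine ⟨fun a ↦ absk_nonneg p k _, fun a b ↦ ?_, fun c a ↦ ?_⟩
      · beta_reduce
        rw [hpair_add_left]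
        exact absk_add_le p k _ _
      · beta_reduce
        rw [hpair_smul_left, absk_mul]
    have hsub (a b : K) : pairing (a - b) y = pairing a y - pairing b y := by
      rw [eq_sub_iff_add_eq, ← hpair_add_left, sub_add_cancel]
    have hle : indTop p k K Kn Knorm ≤
        seminormFamilyTop K {fun a ↦ absk p k (pairing a y)} := by
      refine sInf_le ⟨⟨_, by simpa using hf, rfl⟩, fun n ↦ continuous_generateFrom_iff.2 ?_⟩
      rintro _ ⟨_, rfl, x, ε, hε, rfl⟩
      simp only [Set.preimage_ofPred_eq, hsub]
      refine isOpen_setOf_absk_sub_lt p k _ (g := fun z : Kn n ↦ pairing z y)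
        (fun z ε hε ↦ ?_) _ _ hε
      obtain ⟨δ, hδ, h⟩ := hballs n ⟨y.1 n, y.2.1 n⟩ ε hε
      refine ⟨{w | Knorm (w - z) < δ},
        ⟨_, TopologicalSpace.isOpen_generateFrom_of_mem ⟨(z : K), δ, hδ, rfl⟩, rfl⟩, ?_,
        fun w hw ↦ ?_⟩
      · rwa [Set.mem_ofPred_eq, sub_self, hKnorm_zero]
      · rw [hmem_pair, hmem_pair, mul_comm w, mul_comm z]
        exact h w z hw
    refine continuous_kTop p k _ fun x ε hε ↦ ?_
    refine ⟨{a | absk p k (pairing (a - x) y) < ε},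
      hle _ (TopologicalSpace.isOpen_generateFrom_of_mem ⟨_, rfl, x, ε, hε, rfl⟩), ?_,
      fun a ha ↦ ?_⟩
    · rwa [Set.mem_ofPred_eq, hsub, sub_self, absk_zero]
    · rwa [← hsub]
  · rintro ψ ⟨hψ, -⟩
    choose y hy using fun n ↦ exists_forall_trace_mul_eq
      ((finrank k (Kn n) : k) • (hψ.mk' ψ).comp (Kn n).val.toLinearMap)
    have hy' (n : ℕ) (a : Kn n) :
        (finrank k (Kn n) : k)⁻¹ * Algebra.trace k (Kn n) (a * y n) = ψ a := by
      rw [hy, LinearMap.smul_apply, smul_eq_mul, inv_mul_cancel_left₀ (hm n)]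
      rfl
    have hcompat ⦃n ν : ℕ⦄ (h : n ≤ ν) : T n (y ν) = y n := by
      refine congrArg Subtype.val (?_ : (⟨T n (y ν), hTmem n _⟩ : Kn n) = y n)
      refine eq_of_forall_trace_mul_eq (k := k) fun a ↦ ?_
      refine mul_left_cancel₀ (inv_ne_zero (hm n)) ?_
      rw [hTtrace n ν h, hy', hy']
      rfl
    let Y : ProjLim k K Kn T := ⟨fun n ↦ y n, fun n ↦ (y n).2, hcompat⟩
    refine ⟨Y, fun a ↦ ?_, fun z hz ↦ ?_⟩
    · obtain ⟨n, ha⟩ := hunion a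
      exact (hy' n ⟨a, ha⟩).symm.trans (hmem_pair n Y ⟨a, ha⟩).symm
    · refine Subtype.ext (funext fun n ↦ ?_)
      refine congrArg Subtype.val (?_ : (⟨z.1 n, z.2.1 n⟩ : Kn n) = y n)
      refine eq_of_forall_trace_mul_eq (k := k) fun a ↦ ?_
      refine mul_left_cancel₀ (inv_ne_zero (hm n)) ?_
      rw [hy', ← hmem_pair, hz]
  · refine (@dense_iff_inter_open _ (projTop k K Kn T Knorm) _).2 ?_
    rintro U hU ⟨x, hx⟩
    obtain ⟨N, hN⟩ := exists_forall_eq_imp_mem_of_isOpen_projTop hU hx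
    exact ⟨emb k K Kn T hTmem hTproj (x.1 N), hN _ (hTid N _ (x.2.1 N)), x.1 N, rfl⟩
end

section
/- Assume in addition that each extension K_n/k is Galois, and let G be the group of field automorphisms of K fixing k pointwise. For every g ∈ G there is a unique map ḡ : K̄ → K̄ which extends the action of g on K ⊆ K̄ and is continuous with respect to the weak topology σ(K̄, K); moreover g ↦ ḡ defines an action of G on K̄ by k-linear maps. -/
open MeasureTheory Module
open scoped Classical

section GaloisAction

variable {p : ℕ} [Fact p.Prime]
variable {k : Type} [Field k] [Algebra ℚ_[p] k]
variable {K : Type} [Field K] [Algebra k K]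

theorem absk_eq_zero_iff [FiniteDimensional ℚ_[p] k] {x : k} : absk p k x = 0 ↔ x = 0 := by
  rw [absk, norm_eq_zero, Algebra.norm_eq_zero_iff]

/-- In the topology of `k`, distinct points are separated by a ball around one of them. -/
theorem eq_of_forall_isOpen_kTop [FiniteDimensional ℚ_[p] k] {c d : k}
    (h : ∀ U : Set k, @IsOpen _ (kTop p k) U → d ∈ U → c ∈ U) : c = d := by
  by_contra hne
  have hpos : 0 < absk p k (c - d) :=
    lt_of_le_of_ne (norm_nonneg _) fun h0 => hne (sub_eq_zero.1 (absk_eq_zero_iff.1 h0.symm))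
  have hmem := h {y | absk p k (y - d) < absk p k (c - d)}
    (TopologicalSpace.isOpen_generateFrom_of_mem ⟨d, _, hpos, rfl⟩)
    (by simpa only [Set.mem_ofPred_eq, sub_self, absk_eq_zero_iff.2 rfl] using hpos)
  exact lt_irrefl (absk p k (c - d)) hmem

theorem algEquiv_apply_mem (g : K ≃ₐ[k] K) (E : IntermediateField k K) [Normal k E] {x : K}
    (hx : x ∈ E) : g x ∈ E := by
  have h := AlgEquiv.restrictNormal_commutes g E ⟨x, hx⟩
  exact h ▸ (g.restrictNormal E ⟨x, hx⟩).2

theorem restrictNormal_mk (g : K ≃ₐ[k] K) (E : IntermediateField k K) [Normal k E] {x : K}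
    (hx : x ∈ E) : g.restrictNormal E ⟨x, hx⟩ = ⟨g x, algEquiv_apply_mem g E hx⟩ :=
  Subtype.ext (AlgEquiv.restrictNormal_commutes g E ⟨x, hx⟩)

theorem coe_relTrace_algEquiv (g : K ≃ₐ[k] K) (E F : IntermediateField k K) [Normal k E]
    [Normal k F] (h : E ≤ F) {x : K} (hx : x ∈ F) :
    (relTrace k K E F h ⟨g x, algEquiv_apply_mem g F hx⟩ : K) =
      g (relTrace k K E F h ⟨x, hx⟩ : K) := by
  let : Algebra E F := (IntermediateField.inclusion h).toRingHom.toAlgebra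
  have key := Algebra.trace_eq_of_equiv_equiv (g.restrictNormal E).toRingEquiv
    (g.restrictNormal F).toRingEquiv (by
      ext y
      have hE := AlgEquiv.restrictNormal_commutes g E y
      have hF := AlgEquiv.restrictNormal_commutes g F (IntermediateField.inclusion h y)
      exact hE.trans hF.symm) ⟨x, hx⟩
  rw [RingEquiv.eq_symm_apply] at key
  have hc := AlgEquiv.restrictNormal_commutes g E (Algebra.trace E F ⟨x, hx⟩)
  have hm := restrictNormal_mk g F hx
  change _ = Algebra.trace E F (g.restrictNormal F ⟨x, hx⟩) at key
  rw [hm] at key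
  exact (congrArg Subtype.val key).symm.trans hc

variable {Kn : ℕ → IntermediateField k K} {T : ℕ → K →ₗ[k] K}

/-- The coordinatewise action of an automorphism commuting with the maps `T n` on `K̄`. -/
def projLimMap [∀ n, Normal k (Kn n)] (g : K ≃ₐ[k] K) (hg : ∀ n x, T n (g x) = g (T n x))
    (x : ProjLim k K Kn T) : ProjLim k K Kn T :=
  ⟨fun n => g (x.1 n), fun n => algEquiv_apply_mem g (Kn n) (x.2.1 n), fun n ν h => by
    rw [hg, x.2.2 h]⟩

theorem continuous_weakTop_of_pairing {pairing : K → ProjLim k K Kn T → k}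
    (f : ProjLim k K Kn T → ProjLim k K Kn T) (e : K → K)
    (hf : ∀ a x, pairing a (f x) = pairing (e a) x) :
    @Continuous _ _ (weakTop p k K Kn T pairing) (weakTop p k K Kn T pairing) f := by
  refine continuous_iInf_rng.2 fun a => continuous_induced_rng.2 ?_
  have h : pairing a ∘ f = pairing (e a) := funext (hf a)
  rw [h]
  exact continuous_iInf_dom (i := e a) continuous_induced_dom

theorem tendsto_weakTop_of_eventually_eq {pairing : K → ProjLim k K Kn T → k}
    {u : ℕ → ProjLim k K Kn T} {x : ProjLim k K Kn T}
    (h : ∀ a, ∀ᶠ ν in Filter.atTop, pairing a (u ν) = pairing a x) :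
    Filter.Tendsto u Filter.atTop (@nhds _ (weakTop p k K Kn T pairing) x) := by
  rw [weakTop, nhds_iInf, Filter.tendsto_iInf]
  intro a
  let := kTop p k
  rw [nhds_induced, Filter.tendsto_comap_iff]
  exact tendsto_nhds_of_eventually_eq (h a)

/-- A sequence in `K̄` whose pairings with each `a` are eventually equal to those of `x` has no
weak limit other than a point with the same pairings as `x`. -/
theorem pairing_eq_of_tendsto_weakTop [FiniteDimensional ℚ_[p] k]
    {pairing : K → ProjLim k K Kn T → k}
    {u : ℕ → ProjLim k K Kn T} {x y : ProjLim k K Kn T}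
    (h : ∀ a, ∀ᶠ ν in Filter.atTop, pairing a (u ν) = pairing a x)
    (hy : Filter.Tendsto u Filter.atTop (@nhds _ (weakTop p k K Kn T pairing) y)) (a : K) :
    pairing a x = pairing a y := by
  refine eq_of_forall_isOpen_kTop (p := p) fun U hU hyU => ?_
  let := weakTop p k K Kn T pairing
  let := kTop p k
  have hc : Continuous (pairing a) := continuous_iInf_dom (i := a) continuous_induced_dom
  obtain ⟨ν, hν, hν'⟩ :=
    ((h a).and (((hc.tendsto y).comp hy).eventually (hU.mem_nhds hyU))).exists
  exact hν ▸ hν'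

theorem projLim_ext_of_pairing [CharZero k] [∀ n, FiniteDimensional k (Kn n)]
    [∀ n, Algebra.IsSeparable k (Kn n)] {pairing : K → ProjLim k K Kn T → k}
    (hpair : ∀ (n : ℕ) (a : K) (ha : a ∈ Kn n) (x : ProjLim k K Kn T),
      pairing a x = (finrank k (Kn n) : k)⁻¹ *
        Algebra.trace k (Kn n) (⟨a * x.1 n, mul_mem ha (x.2.1 n)⟩ : Kn n))
    {x y : ProjLim k K Kn T} (h : ∀ a, pairing a x = pairing a y) : x = y := by
  refine Subtype.ext (funext fun n => ?_)
  have hfin : (finrank k (Kn n) : k) ≠ 0 := Nat.cast_ne_zero.2 finrank_pos.ne'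
  have hxy : (⟨x.1 n, x.2.1 n⟩ - ⟨y.1 n, y.2.1 n⟩ : Kn n) = 0 := by
    refine (traceForm_nondegenerate k (Kn n)).1 _ fun a => ?_
    have ha := h a
    rw [hpair n a a.2, hpair n a a.2] at ha
    have ha' := mul_left_cancel₀ (inv_ne_zero hfin) ha
    rw [Algebra.traceForm_apply, mul_comm, mul_sub, map_sub, sub_eq_zero]
    exact ha'
  exact congrArg Subtype.val (sub_eq_zero.1 hxy)

end GaloisAction

theorem statement_4
    (p : ℕ) [Fact (Nat.Prime p)]
    (k : Type) [Field k] [Algebra ℚ_[p] k] [FiniteDimensional ℚ_[p] k]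
    (K : Type) [Field K] [Algebra k K] [CharZero K]
    (Kn : ℕ → IntermediateField k K)
    (hbot : Kn 1 = ⊥) (hmono : Monotone Kn)
    [hfd : ∀ n, FiniteDimensional k (Kn n)]
    (hunion : ∀ x : K, ∃ n, x ∈ Kn n)
    (T : ℕ → K →ₗ[k] K)
    (hTmem : ∀ (n : ℕ) (x : K), T n x ∈ Kn n)
    (hTdef : ∀ (n ν : ℕ) (h : n ≤ ν) (x : K) (hx : x ∈ Kn ν),
      T n x = ((finrank k (Kn n) : K) / (finrank k (Kn ν) : K)) *
        (relTrace k K (Kn n) (Kn ν) (hmono h) ⟨x, hx⟩ : K))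
    (pairing : K → ProjLim k K Kn T → k)
    (hpair : ∀ (n : ℕ) (a : K) (ha : a ∈ Kn n) (x : ProjLim k K Kn T),
      pairing a x = (finrank k (Kn n) : k)⁻¹ *
        Algebra.trace k (Kn n) (⟨a * x.1 n, mul_mem ha (x.2.1 n)⟩ : Kn n))
    (hTproj : ∀ ⦃n ν : ℕ⦄, n ≤ ν → ∀ x : K, T n (T ν x) = T n x)
    [hgal : ∀ n, IsGalois k (Kn n)] :
    (∀ g : K ≃ₐ[k] K, ∃! gb : ProjLim k K Kn T → ProjLim k K Kn T,
      (∀ x : K, gb (emb k K Kn T hTmem hTproj x) = emb k K Kn T hTmem hTproj (g x)) ∧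
      @Continuous _ _ (weakTop p k K Kn T pairing) (weakTop p k K Kn T pairing) gb) ∧
    ∃ E : (K ≃ₐ[k] K) → ProjLim k K Kn T → ProjLim k K Kn T,
      (∀ g : K ≃ₐ[k] K,
        (∀ x : K, E g (emb k K Kn T hTmem hTproj x) = emb k K Kn T hTmem hTproj (g x)) ∧
        @Continuous _ _ (weakTop p k K Kn T pairing) (weakTop p k K Kn T pairing) (E g)) ∧
      (∀ (g : K ≃ₐ[k] K) (x y : ProjLim k K Kn T),
        E g (pladd k K Kn T x y) = pladd k K Kn T (E g x) (E g y)) ∧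
      (∀ (g : K ≃ₐ[k] K) (c : k) (x : ProjLim k K Kn T),
        E g (plsmul k K Kn T c x) = plsmul k K Kn T c (E g x)) ∧
      (E 1 = id) ∧
      (∀ g₁ g₂ : K ≃ₐ[k] K, E (g₁ * g₂) = E g₁ ∘ E g₂) := by
  have : CharZero k := charZero_of_injective_algebraMap (algebraMap ℚ_[p] k).injective
  have hlevel : ∀ (n : ℕ) (x : K), ∃ ν, n ≤ ν ∧ x ∈ Kn ν := fun n x => by
    obtain ⟨ν, hν⟩ := hunion x
    exact ⟨max n ν, le_max_left _ _, hmono (le_max_right _ _) hν⟩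
  have hcomm : ∀ (g : K ≃ₐ[k] K) (n : ℕ) (x : K), T n (g x) = g (T n x) := fun g n x => by
    obtain ⟨ν, hn, hx⟩ := hlevel n x
    rw [hTdef n ν hn _ (algEquiv_apply_mem g _ hx), hTdef n ν hn x hx,
      coe_relTrace_algEquiv, map_mul, map_div₀, map_natCast, map_natCast]
  let E (g : K ≃ₐ[k] K) : ProjLim k K Kn T → ProjLim k K Kn T := projLimMap g (hcomm g)
  have hemb : ∀ (g : K ≃ₐ[k] K) (x : K),
      E g (emb k K Kn T hTmem hTproj x) = emb k K Kn T hTmem hTproj (g x) := fun g x =>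
    Subtype.ext (funext fun n => (hcomm g n x).symm)
  have hcont : ∀ g : K ≃ₐ[k] K,
      @Continuous _ _ (weakTop p k K Kn T pairing) (weakTop p k K Kn T pairing) (E g) := by
    refine fun g => continuous_weakTop_of_pairing _ g.symm fun a x => ?_
    obtain ⟨n, ha⟩ := hunion a
    have ha' := algEquiv_apply_mem g.symm (Kn n) ha
    rw [hpair n a ha, hpair n _ ha',
      ← Algebra.trace_eq_of_algEquiv (g.restrictNormal (Kn n)) ⟨g.symm a * x.1 n, _⟩,
      restrictNormal_mk]
    congr 3
    rw [map_mul, AlgEquiv.apply_symm_apply]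
    rfl
  have happrox : ∀ (x : ProjLim k K Kn T) (a : K), ∀ᶠ ν in Filter.atTop,
      pairing a (emb k K Kn T hTmem hTproj (x.1 ν)) = pairing a x := fun x a => by
    obtain ⟨n, ha⟩ := hunion a
    filter_upwards [Filter.eventually_ge_atTop n] with ν hν
    rw [hpair n a ha, hpair n a ha]
    congr 3
    exact congrArg (a * ·) (x.2.2 hν)
  refine ⟨fun g => ⟨E g, ⟨hemb g, hcont g⟩, ?_⟩, E, fun g => ⟨hemb g, hcont g⟩, ?_, ?_, ?_, ?_⟩
  · rintro f ⟨hf, hfc⟩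
    funext x
    let := weakTop p k K Kn T pairing
    have hlim := (hfc.tendsto x).comp (tendsto_weakTop_of_eventually_eq (p := p) (happrox x))
    refine (projLim_ext_of_pairing hpair
      (pairing_eq_of_tendsto_weakTop (fun a => ?_) hlim)).symm
    simp only [Function.comp_apply, hf]
    exact happrox (E g x) a
  · exact fun g x y => Subtype.ext (funext fun n => map_add g _ _)
  · exact fun g c x => Subtype.ext (funext fun n => g.toLinearMap.map_smul c (x.1 n))
  · rfl
  · exact fun _ _ => rfl
end

section
/- There exists exactly one Radon probability measure μ on the Borel σ-algebra of K̄ such that ∫_{K̄} χ(⟨a,x⟩) dμ(x) = Ω(a) for every a ∈ K, where Ω(a) = 1 if ‖a‖ ≤ 1 and Ω(a) = 0 if ‖a‖ > 1. -/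
open MeasureTheory Module
open scoped Classical

section MeasureExt

open BoundedContinuousFunction

theorem measure_ext_of_submonoid {E : Type*} [TopologicalSpace E] [PolishSpace E]
    [MeasurableSpace E] [BorelSpace E] {P P' : Measure E} [IsFiniteMeasure P] [IsFiniteMeasure P']
    (S : Submonoid (E →ᵇ ℂ)) (hstar : ∀ f ∈ S, star f ∈ S)
    (hsep : ∀ x y : E, x ≠ y → ∃ f ∈ S, f x ≠ f y)
    (heq : ∀ f ∈ S, ∫ x, f x ∂P = ∫ x, f x ∂P') : P = P' := by
  have hspan : ∀ f, f ∈ Algebra.adjoin ℂ (S : Set (E →ᵇ ℂ)) ↔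
      f ∈ Submodule.span ℂ (S : Set (E →ᵇ ℂ)) := by
    intro f
    rw [← Subalgebra.mem_toSubmodule, Algebra.adjoin_eq_span, Submonoid.closure_eq]
  let A : StarSubalgebra ℂ (E →ᵇ ℂ) :=
    { Algebra.adjoin ℂ (S : Set (E →ᵇ ℂ)) with
      star_mem' := by
        intro f hf
        change f ∈ Algebra.adjoin ℂ (S : Set (E →ᵇ ℂ)) at hf
        change star f ∈ Algebra.adjoin ℂ (S : Set (E →ᵇ ℂ))
        rw [hspan] at hf ⊢
        induction hf using Submodule.span_induction with
        | mem f hf => exact Submodule.subset_span (hstar f hf)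
        | zero => simp
        | add f g _ _ hf hg => rw [star_add]; exact add_mem hf hg
        | smul c f _ hf => rw [star_smul]; exact Submodule.smul_mem _ _ hf }
  have hA : ∀ f, f ∈ A ↔ f ∈ Algebra.adjoin ℂ (S : Set (E →ᵇ ℂ)) := fun f => Iff.rfl
  refine ext_of_forall_mem_subalgebra_integral_eq_of_polish (𝕜 := ℂ) (A := A) ?_ ?_
  · intro x y hxy
    obtain ⟨f, hf, hne⟩ := hsep x y hxy
    exact ⟨f, ⟨toContinuousMapStarₐ ℂ f, ⟨f, Algebra.subset_adjoin hf, rfl⟩, rfl⟩, hne⟩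
  · intro f hf
    rw [hA, hspan] at hf
    induction hf using Submodule.span_induction with
    | mem f hf => exact heq f hf
    | zero => simp
    | add f g _ _ hf hg =>
      simp only [coe_add, Pi.add_apply]
      rw [integral_add (f.integrable _) (g.integrable _),
        integral_add (f.integrable _) (g.integrable _), hf, hg]
    | smul c f _ hf =>
      simp only [coe_smul]
      rw [integral_smul, integral_smul, hf]

end MeasureExt

theorem integral_eq_zero_of_translate {G : Type*} [AddGroup G] [MeasurableSpace G]
    [MeasurableAdd G] (μ : Measure G) [μ.IsAddLeftInvariant] (ψ : G → ℂ)
    (hψ : ∀ x y, ψ (x + y) = ψ x * ψ y) (g : G) (hg : ψ g ≠ 1) : ∫ x, ψ x ∂μ = 0 := by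
  have h := integral_add_left_eq_self (μ := μ) ψ g
  simp only [hψ] at h
  rw [integral_const_mul] at h
  have h' : (ψ g - 1) * ∫ x, ψ x ∂μ = 0 := by rw [sub_mul, h]; ring
  exact (mul_eq_zero.mp h').resolve_left (sub_ne_zero.mpr hg)

section Polar

variable {k K : Type} [NontriviallyNormedField k] [NormedField K] [NormedAlgebra k K]

/-- The polar of the unit ball of an intermediate field `E` with respect to `(a, b) ↦ t (a * b)`. -/
def polarBall (t : K →ₗ[k] k) (E : IntermediateField k K) : Set K :=
  {y | y ∈ E ∧ ∀ b ∈ E, ‖b‖ ≤ 1 → ‖t (b * y)‖ ≤ 1}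

variable {t : K →ₗ[k] k} {E E' : IntermediateField k K}

theorem polarBall_mul_mem {a y : K} (ha : a ∈ E) (ha1 : ‖a‖ ≤ 1) (hy : y ∈ polarBall t E) :
    a * y ∈ polarBall t E := by
  refine ⟨mul_mem ha hy.1, fun b hb hb1 => ?_⟩
  rw [← mul_assoc]
  refine hy.2 _ (mul_mem hb ha) ?_
  rw [norm_mul]
  exact mul_le_one₀ hb1 (norm_nonneg _) ha1

theorem polarBall_zero_mem : (0 : K) ∈ polarBall t E := ⟨zero_mem _, by simp⟩

theorem polarBall_norm_lt (ht : t 1 = 1) {y : K} (hy : y ∈ polarBall t E) {w : k}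
    (hw : 1 < ‖w‖) : ‖y‖ < ‖w‖ := by
  by_contra! h
  have hy0 : y ≠ 0 := by
    rintro rfl
    simp only [norm_zero] at h
    linarith
  have h1 := hy.2 (algebraMap k K w * y⁻¹) (mul_mem (E.algebraMap_mem w) (inv_mem hy.1)) (by
    rw [norm_mul, norm_inv, norm_algebraMap', ← div_eq_mul_inv]
    exact div_le_one_of_le₀ h (norm_nonneg _))
  rw [mul_assoc, inv_mul_cancel₀ hy0, mul_one, Algebra.algebraMap_eq_smul_one, map_smul, ht,
    smul_eq_mul, mul_one] at h1
  linarith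

theorem continuous_comp_subtype [CompleteSpace k] [FiniteDimensional k E] {V : Type*}
    [NormedAddCommGroup V] [NormedSpace k V] (f : K →ₗ[k] V) : Continuous fun y : E => f y :=
  (f.comp E.val.toLinearMap).continuous_of_finiteDimensional

theorem polarBall_exists_ne_zero [CompleteSpace k] [FiniteDimensional k E] :
    ∃ y ∈ polarBall t E, y ≠ 0 := by
  let f : E →L[k] k := LinearMap.toContinuousLinearMap (t.comp E.val.toLinearMap)
  have hf : ∀ y : E, f y = t y := fun y => rfl
  obtain ⟨c, hc⟩ := NormedField.exists_lt_norm k ‖f‖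
  have hc0 : 0 < ‖c‖ := (norm_nonneg _).trans_lt hc
  have hc' : c ≠ 0 := norm_pos_iff.mp hc0
  refine ⟨algebraMap k K c⁻¹, ⟨E.algebraMap_mem _, fun b hb hb1 => ?_⟩, by simpa using hc'⟩
  rw [mul_comm, ← Algebra.smul_def, map_smul, norm_smul, norm_inv, inv_mul_le_one₀ hc0]
  have h := f.le_opNorm ⟨b, hb⟩
  rw [hf] at h
  refine h.trans ((mul_le_of_le_one_right (norm_nonneg _) hb1).trans hc.le)

theorem polarBall_not_stable [CompleteSpace k] [FiniteDimensional k E] (ht : t 1 = 1) {a : K}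
    (ha : 1 < ‖a‖) : ¬ ∀ y ∈ polarBall t E, a * y ∈ polarBall t E := by
  intro h
  obtain ⟨y, hy, hy0⟩ := polarBall_exists_ne_zero (t := t) (E := E)
  have hpow : ∀ j : ℕ, a ^ j * y ∈ polarBall t E := by
    intro j
    induction j with
    | zero => simpa using hy
    | succ j ih => rw [pow_succ', mul_assoc]; exact h _ ih
  obtain ⟨w, hw⟩ := NormedField.exists_one_lt_norm k
  obtain ⟨j, hj⟩ := pow_unbounded_of_one_lt (‖w‖ / ‖y‖) ha
  have h1 := polarBall_norm_lt ht (hpow j) hw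
  rw [norm_mul, norm_pow] at h1
  rw [div_lt_iff₀ (norm_pos_iff.mpr hy0)] at hj
  linarith

theorem polarBall_exists_one_lt [CompleteSpace k] [FiniteDimensional k E] (ht : t 1 = 1) {a : K}
    (haE : a ∈ E) (ha : 1 < ‖a‖) : ∃ y ∈ polarBall t E, 1 < ‖t (a * y)‖ := by
  by_contra! h
  refine polarBall_not_stable (E := E) ht ha fun y hy => ⟨mul_mem haE hy.1, fun b hb hb1 => ?_⟩
  rw [mul_left_comm]
  exact h _ (polarBall_mul_mem hb hb1 hy)

theorem isCompact_polarBall [ProperSpace k] [FiniteDimensional k E] (ht : t 1 = 1) :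
    IsCompact {y : E | (y : K) ∈ polarBall t E} := by
  have : ProperSpace E := FiniteDimensional.proper k E
  obtain ⟨w, hw⟩ := NormedField.exists_one_lt_norm k
  refine Metric.isCompact_of_isClosed_isBounded ?_ ?_
  · have : {y : E | (y : K) ∈ polarBall t E} =
        ⋂ b ∈ {b : E | ‖b‖ ≤ 1}, {y : E | ‖t (b * y)‖ ≤ 1} := by
      ext y
      simp only [polarBall, Set.mem_ofPred_eq, Set.mem_iInter]
      exact ⟨fun h b hb => h.2 b b.2 hb, fun h => ⟨y.2, fun b hb hb1 => h ⟨b, hb⟩ hb1⟩⟩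
    rw [this]
    refine isClosed_biInter fun b _ => isClosed_le ?_ continuous_const
    exact (continuous_comp_subtype (E := E) (t.comp (LinearMap.mulLeft k (b : K)))).norm
  · refine isBounded_iff_forall_norm_le.mpr ⟨‖w‖, fun y hy => ?_⟩
    exact (polarBall_norm_lt ht hy hw).le

theorem polarBall_map {S : K →ₗ[k] K} (hS : ∀ x, S x ∈ E)
    (hmul : ∀ a ∈ E, ∀ x, S (a * x) = a * S x) (htS : ∀ x, t (S x) = t x) (hE : E ≤ E') {z : K}
    (hz : z ∈ polarBall t E') : S z ∈ polarBall t E := by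
  refine ⟨hS z, fun b hb hb1 => ?_⟩
  rw [← hmul b hb, htS]
  exact hz.2 b (hE hb) hb1

theorem polarBall_surj [CompleteSpace k] [FiniteDimensional k E'] (ht : t 1 = 1)
    {S : K →ₗ[k] K} (hmul : ∀ a ∈ E, ∀ x, S (a * x) = a * S x)
    (hS : ∀ x, S x ∈ E) (htS : ∀ x, t (S x) = t x) (hE : E ≤ E')
    (hπ : ∃ π ∈ E, π ≠ 0 ∧ ‖π‖ < 1 ∧ ∀ x ∈ E, ‖x‖ < 1 → ‖x‖ ≤ ‖π‖)
    {y : K} (hy : y ∈ polarBall t E) : ∃ z ∈ polarBall t E', S z = y := by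
  by_contra! h
  obtain ⟨π, hπE, hπ0, hπ1, hπmax⟩ := hπ
  have hy0 : y ≠ 0 := fun h0 => h 0 polarBall_zero_mem (by rw [map_zero, h0])
  have hypos : 0 < ‖y‖ := norm_pos_iff.mpr hy0
  have hlt : ∀ z ∈ polarBall t E', ‖S z‖ < ‖y‖ := by
    intro z hz
    by_contra! hle
    have hSz : S z ≠ 0 := norm_pos_iff.mp (hypos.trans_le hle)
    have hc : y / S z ∈ E := div_mem hy.1 (hS z)
    refine h (y / S z * z) (polarBall_mul_mem (hE hc) ?_ hz) ?_
    · rw [norm_div]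
      exact div_le_one_of_le₀ hle (norm_nonneg _)
    · rw [hmul _ hc, div_mul_cancel₀ _ hSz]
  have hmem : ∀ z ∈ polarBall t E', π⁻¹ * S z ∈ polarBall t E := by
    intro z hz
    have h1 : ‖S z / y‖ ≤ ‖π‖ := hπmax _ (div_mem (hS z) hy.1) (by
      rw [norm_div, div_lt_one hypos]; exact hlt z hz)
    have h2 : π⁻¹ * S z = π⁻¹ * (S z / y) * y := by field_simp
    rw [h2]
    refine polarBall_mul_mem (mul_mem (inv_mem hπE) (div_mem (hS z) hy.1)) ?_ hy
    rw [norm_mul, norm_inv]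
    exact inv_mul_le_one_of_le₀ h1 (norm_nonneg _)
  have hπinv : 1 < ‖π⁻¹‖ := by
    rw [norm_inv]
    exact (one_lt_inv₀ (norm_pos_iff.mpr hπ0)).mpr hπ1
  refine polarBall_not_stable (E := E') ht hπinv fun z hz =>
    ⟨mul_mem (hE (inv_mem hπE)) hz.1, fun b hb hb1 => ?_⟩
  have h3 := (hmem _ (polarBall_mul_mem hb hb1 hz)).2 1 (one_mem _) (by simp)
  rwa [one_mul, ← hmul _ (inv_mem hπE), htS, mul_left_comm] at h3

end Polar

section ProjectiveLimit

variable {k K : Type} [NontriviallyNormedField k] [NormedField K] [NormedAlgebra k K]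
variable {F : ℕ → IntermediateField k K} {T : ℕ → K →ₗ[k] K} {t : K →ₗ[k] k}

/-- The inclusion of the projective limit in the product of its terms. -/
def projToPi (x : ProjLim k K F T) : ∀ n, F n := fun n => ⟨x.1 n, x.2.1 n⟩

theorem projToPi_injective : Function.Injective (projToPi : ProjLim k K F T → ∀ n, F n) := by
  intro x y h
  refine Subtype.ext (funext fun n => ?_)
  exact congrArg Subtype.val (congrFun h n)

theorem range_projToPi : Set.range (projToPi : ProjLim k K F T → ∀ n, F n) =
    {x | ∀ n ν, n ≤ ν → T n (x ν) = x n} := by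
  ext x
  constructor
  · rintro ⟨y, rfl⟩ n ν h
    exact y.2.2 h
  · intro h
    exact ⟨⟨fun n => x n, fun n => (x n).2, fun n ν hν => h n ν hν⟩, rfl⟩

theorem isClosed_range_projToPi [CompleteSpace k] [∀ n, FiniteDimensional k (F n)] :
    IsClosed (Set.range (projToPi : ProjLim k K F T → ∀ n, F n)) := by
  rw [range_projToPi]
  simp only [Set.ofPred_forall]
  refine isClosed_iInter fun n => isClosed_iInter fun ν => isClosed_iInter fun _ => ?_
  exact isClosed_eq ((continuous_comp_subtype (T n)).comp (continuous_apply ν))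
    (continuous_subtype_val.comp (continuous_apply n))

theorem projTop_eq_induced {Knorm : K → ℝ} {d : ℕ} (hd : d ≠ 0)
    (hKnorm : ∀ x, Knorm x = ‖x‖ ^ d) :
    projTop k K F T Knorm = TopologicalSpace.induced projToPi Pi.topologicalSpace := by
  apply le_antisymm
  · rw [← continuous_iff_le_induced]
    let _ : TopologicalSpace (ProjLim k K F T) := projTop k K F T Knorm
    refine continuous_pi fun n => continuous_iff_continuousAt.mpr fun x => ?_
    refine Metric.tendsto_nhds.mpr fun ε hε => ?_
    have hopen : IsOpen {y : ProjLim k K F T | Knorm (y.1 n - x.1 n) < ε ^ d} :=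
      TopologicalSpace.isOpen_generateFrom_of_mem ⟨x, n, ε ^ d, pow_pos hε d, rfl⟩
    have hx : x ∈ {y : ProjLim k K F T | Knorm (y.1 n - x.1 n) < ε ^ d} := by
      simp only [Set.mem_ofPred_eq, sub_self, hKnorm, norm_zero, zero_pow hd]
      exact pow_pos hε d
    filter_upwards [hopen.mem_nhds hx] with y hy
    simp only [hKnorm] at hy
    rw [dist_eq_norm]
    exact lt_of_pow_lt_pow_left₀ d hε.le hy
  · refine le_generateFrom ?_
    rintro U ⟨x, n, ε, -, rfl⟩
    let _ : TopologicalSpace (ProjLim k K F T) :=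
      TopologicalSpace.induced projToPi Pi.topologicalSpace
    have hind : Continuous (projToPi : ProjLim k K F T → ∀ n, F n) := continuous_induced_dom
    have hc : Continuous fun y : ProjLim k K F T => (projToPi y n : K) :=
      continuous_subtype_val.comp ((continuous_apply n).comp hind)
    simp only [hKnorm]
    exact isOpen_lt ((hc.sub continuous_const).norm.pow d) continuous_const

theorem polishSpace_projLim [ProperSpace k] [∀ n, FiniteDimensional k (F n)] {Knorm : K → ℝ}
    {d : ℕ} (hd : d ≠ 0) (hKnorm : ∀ x, Knorm x = ‖x‖ ^ d) :
    @PolishSpace _ (projTop k K F T Knorm) := by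
  have : ∀ n, ProperSpace (F n) := fun n => FiniteDimensional.proper k (F n)
  let _ : TopologicalSpace (ProjLim k K F T) := projTop k K F T Knorm
  have he : Topology.IsClosedEmbedding (projToPi : ProjLim k K F T → ∀ n, F n) :=
    ⟨⟨⟨projTop_eq_induced hd hKnorm⟩, projToPi_injective⟩, isClosed_range_projToPi⟩
  exact he.polishSpace

/-- The elements of the projective limit all of whose terms lie in the polar of the unit ball. -/
def polarProj [IsUltrametricDist k] (F : ℕ → IntermediateField k K) (T : ℕ → K →ₗ[k] K)
    (t : K →ₗ[k] k) : AddSubgroup (∀ n, F n) where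
  carrier := {x | (∀ n ν, n ≤ ν → T n (x ν) = x n) ∧ ∀ n, (x n : K) ∈ polarBall t (F n)}
  zero_mem' := ⟨by simp, fun n => polarBall_zero_mem⟩
  add_mem' := by
    rintro x y ⟨hx, hx'⟩ ⟨hy, hy'⟩
    refine ⟨fun n ν h => by simp [hx n ν h, hy n ν h], fun n => ⟨(x n + y n).2, fun b hb hb1 => ?_⟩⟩
    simp only [Pi.add_apply, IntermediateField.coe_add, mul_add, map_add]
    exact (IsUltrametricDist.norm_add_le_max _ _).trans
      (max_le ((hx' n).2 b hb hb1) ((hy' n).2 b hb hb1))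
  neg_mem' := by
    rintro x ⟨hx, hx'⟩
    refine ⟨fun n ν h => by simp [hx n ν h], fun n => ⟨(-x n).2, fun b hb hb1 => ?_⟩⟩
    simpa using (hx' n).2 b hb hb1

theorem compactSpace_polarProj [ProperSpace k] [IsUltrametricDist k]
    [∀ n, FiniteDimensional k (F n)] (ht : t 1 = 1) : CompactSpace (polarProj F T t) := by
  refine isCompact_iff_compactSpace.mp ?_
  have : (polarProj F T t : Set (∀ n, F n)) =
      Set.range (projToPi : ProjLim k K F T → ∀ n, F n) ∩
        Set.pi Set.univ fun n => {y : F n | (y : K) ∈ polarBall t (F n)} := by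
    rw [range_projToPi]
    ext x
    simp [polarProj]
  rw [this]
  exact (isCompact_univ_pi fun n => isCompact_polarBall ht).inter_left isClosed_range_projToPi

theorem eq_of_forall_apply_mul_eq {E : IntermediateField k K} (ht : t 1 = 1) {u v : K}
    (hu : u ∈ E) (hv : v ∈ E) (h : ∀ b ∈ E, t (b * u) = t (b * v)) : u = v := by
  by_contra hne
  have h1 := h (u - v)⁻¹ (inv_mem (sub_mem hu hv))
  rw [← sub_eq_zero, ← map_sub, ← mul_sub, inv_mul_cancel₀ (sub_ne_zero.mpr hne), ht] at h1
  exact one_ne_zero h1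

theorem proj_proj (ht : t 1 = 1) (hF : Monotone F) (hTmem : ∀ n x, T n x ∈ F n)
    (hTmul : ∀ n, ∀ a ∈ F n, ∀ x, T n (a * x) = a * T n x) (htT : ∀ n x, t (T n x) = t x)
    {n ν : ℕ} (h : n ≤ ν) (x : K) : T n (T ν x) = T n x := by
  refine eq_of_forall_apply_mul_eq ht (hTmem n _) (hTmem n _) fun b hb => ?_
  rw [← hTmul n b hb, ← hTmul n b hb, htT, htT, ← hTmul ν b (hF h hb), htT]

theorem proj_of_mem (ht : t 1 = 1) (hTmem : ∀ n x, T n x ∈ F n)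
    (hTmul : ∀ n, ∀ a ∈ F n, ∀ x, T n (a * x) = a * T n x) (htT : ∀ n x, t (T n x) = t x)
    {n : ℕ} {x : K} (hx : x ∈ F n) : T n x = x := by
  refine eq_of_forall_apply_mul_eq ht (hTmem n _) hx fun b hb => ?_
  rw [← hTmul n b hb, htT]

theorem exists_polarProj_apply_eq [CompleteSpace k] [IsUltrametricDist k]
    [∀ n, FiniteDimensional k (F n)] (ht : t 1 = 1) (hF : Monotone F)
    (hTmem : ∀ n x, T n x ∈ F n)
    (hTmul : ∀ n, ∀ a ∈ F n, ∀ x, T n (a * x) = a * T n x) (htT : ∀ n x, t (T n x) = t x)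
    (hπ : ∀ n, ∃ π ∈ F n, π ≠ 0 ∧ ‖π‖ < 1 ∧ ∀ x ∈ F n, ‖x‖ < 1 → ‖x‖ ≤ ‖π‖)
    {n : ℕ} {y : K} (hy : y ∈ polarBall t (F n)) : ∃ x ∈ polarProj F T t, (x n : K) = y := by
  have hstep : ∀ (j : ℕ) (z : {z // z ∈ polarBall t (F (n + j))}),
      ∃ z' : {z // z ∈ polarBall t (F (n + (j + 1)))}, T (n + j) z' = z := by
    rintro j ⟨z, hz⟩
    obtain ⟨z', hz', h⟩ := polarBall_surj ht (hTmul (n + j)) (hTmem _) (htT _)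
      (hF (Nat.le_succ (n + j))) (hπ _) hz
    exact ⟨⟨z', hz'⟩, h⟩
  choose g hg using hstep
  obtain ⟨s, hs0, hs⟩ : ∃ s : ∀ j, {z // z ∈ polarBall t (F (n + j))},
      (s 0).1 = y ∧ ∀ j, T (n + j) (s (j + 1)).1 = (s j).1 :=
    ⟨Nat.rec (motive := fun j => {z // z ∈ polarBall t (F (n + j))}) ⟨y, hy⟩ g, rfl,
      fun j => hg j _⟩
  have hpp := fun {a b : ℕ} => proj_proj (n := a) (ν := b) ht hF hTmem hTmul htT
  have hconst : ∀ m i, n + i ≥ m → ∀ j, i ≤ j → T m (s j) = T m (s i) := by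
    intro m i hi j hij
    induction j, hij using Nat.le_induction with
    | base => rfl
    | succ j hij ih => rw [← ih, ← hs j, hpp (by omega)]
  refine ⟨fun m => ⟨T m (s m), hTmem _ _⟩, ⟨fun a b hab => ?_, fun m => ?_⟩, ?_⟩
  · change T a (T b (s b)) = T a (s a)
    rw [hpp hab, hconst a a (by omega) b hab]
  · exact polarBall_map (hTmem m) (hTmul m) (htT m) (hF (by omega)) (s m).2
  · change T n (s n) = y
    rw [hconst n 0 (by omega) n (Nat.zero_le _), hs0]
    exact proj_of_mem ht hTmem hTmul htT hy.1

end ProjectiveLimit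

section Gaussian

open BoundedContinuousFunction

variable {k K : Type} [NontriviallyNormedField k] [NormedField K] [NormedAlgebra k K]

theorem existsUnique_gaussian [ProperSpace k] [IsUltrametricDist k]
    (F : ℕ → IntermediateField k K) [∀ n, FiniteDimensional k (F n)] (hF : Monotone F)
    (hunion : ∀ x : K, ∃ n, x ∈ F n) (T : ℕ → K →ₗ[k] K) (t : K →ₗ[k] k) (ht : t 1 = 1)
    (hTmem : ∀ n x, T n x ∈ F n)
    (hTmul : ∀ n, ∀ a ∈ F n, ∀ x, T n (a * x) = a * T n x) (htT : ∀ n x, t (T n x) = t x)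
    (hπ : ∀ n, ∃ π ∈ F n, π ≠ 0 ∧ ‖π‖ < 1 ∧ ∀ x ∈ F n, ‖x‖ < 1 → ‖x‖ ≤ ‖π‖)
    (Knorm : K → ℝ) {d : ℕ} (hd : d ≠ 0) (hKnorm : ∀ x, Knorm x = ‖x‖ ^ d)
    (pairing : K → ProjLim k K F T → k)
    (hpair : ∀ n, ∀ a ∈ F n, ∀ x, pairing a x = t (a * x.1 n))
    (χ : k → ℂ) (hχadd : ∀ x y, χ (x + y) = χ x * χ y) (hχnorm : ∀ x, ‖χ x‖ = 1)
    (hχcont : Continuous χ) (hχtriv : ∀ x, ‖x‖ ≤ 1 → χ x = 1)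
    (hχrank : ∃ u, χ u ≠ 1 ∧ ∀ c : k, 1 < ‖c‖ → ‖u‖ ≤ ‖c‖) :
    ∃! μ : @Measure (ProjLim k K F T) (projMeas k K F T Knorm),
      IsProbabilityMeasure μ ∧
      (∀ A : Set (ProjLim k K F T), MeasurableSet[projMeas k K F T Knorm] A →
        μ A = ⨆ (C : Set (ProjLim k K F T))
          (_ : C ⊆ A ∧ @IsCompact _ (projTop k K F T Knorm) C), μ C) ∧
      (∀ a : K, ∫ x, χ (pairing a x) ∂μ = if Knorm a ≤ 1 then (1 : ℂ) else 0) := by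
  let _ : TopologicalSpace (ProjLim k K F T) := projTop k K F T Knorm
  let _ : MeasurableSpace (ProjLim k K F T) := projMeas k K F T Knorm
  have _ : BorelSpace (ProjLim k K F T) := ⟨rfl⟩
  have _ : PolishSpace (ProjLim k K F T) := polishSpace_projLim hd hKnorm
  have hind : Topology.IsInducing (projToPi : ProjLim k K F T → ∀ n, F n) :=
    ⟨projTop_eq_induced hd hKnorm⟩
  have hχ0 : χ 0 = 1 := hχtriv 0 (by simp)
  have hχneg : ∀ x, χ (-x) = star (χ x) := by
    intro x
    have h1 : χ x * χ (-x) = 1 := by rw [← hχadd, add_neg_cancel, hχ0]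
    have h2 : χ x * star (χ x) = 1 := by
      rw [Complex.star_def, Complex.mul_conj, Complex.normSq_eq_norm_sq, hχnorm]
      simp
    have h3 : χ x ≠ 0 := by
      intro h
      simp [h] at h1
    exact mul_left_cancel₀ h3 (h1.trans h2.symm)
  have hpair_cont : ∀ a, Continuous (pairing a) := by
    intro a
    obtain ⟨n, hn⟩ := hunion a
    have : pairing a = (fun y : F n => t (a * y)) ∘ (fun y : ∀ n, F n => y n) ∘ projToPi :=
      funext fun x => hpair n a hn x
    rw [this]
    exact (continuous_comp_subtype (E := F n) (t.comp (LinearMap.mulLeft k a))).comp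
      ((continuous_apply n).comp hind.continuous)
  have hpair_add : ∀ a b x, pairing (a + b) x = pairing a x + pairing b x := by
    intro a b x
    obtain ⟨n, hn⟩ := hunion a
    obtain ⟨m, hm⟩ := hunion b
    have ha := hF (le_max_left n m) hn
    have hb := hF (le_max_right n m) hm
    rw [hpair _ _ (add_mem ha hb), hpair _ _ ha, hpair _ _ hb, add_mul, map_add]
  have hpair_zero : ∀ x, pairing 0 x = 0 := fun x => by
    rw [hpair 0 0 (zero_mem _), zero_mul, map_zero]
  have hpair_neg : ∀ a x, pairing (-a) x = -pairing a x := fun a x => by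
    rw [eq_neg_iff_add_eq_zero, ← hpair_add, neg_add_cancel, hpair_zero]
  let ψ : K → (ProjLim k K F T →ᵇ ℂ) := fun a =>
    BoundedContinuousFunction.ofNormedAddCommGroup (fun x => χ (pairing a x))
      (hχcont.comp (hpair_cont a)) 1 fun x => (hχnorm _).le
  have hψ : ∀ a x, ψ a x = χ (pairing a x) := fun _ _ => rfl
  let S : Submonoid (ProjLim k K F T →ᵇ ℂ) :=
    { carrier := Set.range ψ
      one_mem' := ⟨0, by ext x; simp [hψ, hpair_zero, hχ0]⟩
      mul_mem' := by
        rintro _ _ ⟨a, rfl⟩ ⟨b, rfl⟩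
        exact ⟨a + b, by ext x; simp [hψ, hpair_add, hχadd]⟩ }
  obtain ⟨u, hu, humin⟩ := hχrank
  have huniq : ∀ P P' : Measure (ProjLim k K F T), IsProbabilityMeasure P →
      IsProbabilityMeasure P' →
      (∀ a, ∫ x, χ (pairing a x) ∂P = ∫ x, χ (pairing a x) ∂P') → P = P' := by
    intro P P' _ _ h
    refine measure_ext_of_submonoid S ?_ ?_ ?_
    · rintro _ ⟨a, rfl⟩
      exact ⟨-a, by ext x; simp only [hψ, hpair_neg, hχneg]; rfl⟩
    · intro x y hxy
      obtain ⟨n, hn⟩ : ∃ n, x.1 n ≠ y.1 n := by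
        by_contra! h
        exact hxy (Subtype.ext (funext h))
      have hb : algebraMap k K u * (x.1 n - y.1 n)⁻¹ ∈ F n :=
        mul_mem ((F n).algebraMap_mem u) (inv_mem (sub_mem (x.2.1 n) (y.2.1 n)))
      refine ⟨ψ (algebraMap k K u * (x.1 n - y.1 n)⁻¹), ⟨_, rfl⟩, fun heq => hu ?_⟩
      · rw [hψ, hψ, hpair n _ hb, hpair n _ hb] at heq
        have h1 : u = t (algebraMap k K u * (x.1 n - y.1 n)⁻¹ * x.1 n) -
            t (algebraMap k K u * (x.1 n - y.1 n)⁻¹ * y.1 n) := by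
          rw [← map_sub, ← mul_sub, mul_assoc, inv_mul_cancel₀ (sub_ne_zero.mpr hn), mul_one,
            Algebra.algebraMap_eq_smul_one, map_smul, ht, smul_eq_mul, mul_one]
        rw [h1, sub_eq_add_neg, hχadd, heq, ← hχadd, add_neg_cancel, hχ0]
    · rintro _ ⟨a, rfl⟩
      exact h a
  let G := polarProj F T t
  have _ : CompactSpace G := compactSpace_polarProj ht
  let _ : MeasurableSpace G := borel G
  have _ : BorelSpace G := ⟨rfl⟩
  let ν : Measure G := Measure.addHaarMeasure ⊤
  have _ : IsProbabilityMeasure ν := ⟨by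
    simpa using Measure.addHaarMeasure_self (K₀ := (⊤ : TopologicalSpace.PositiveCompacts G))⟩
  let i : G → ProjLim k K F T := fun x =>
    ⟨fun n => x.1 n, fun n => (x.1 n).2, fun n ν h => x.2.1 n ν h⟩
  have hi : Continuous i := by
    rw [hind.continuous_iff]
    exact continuous_subtype_val
  have hadd : ∀ a x y, χ (pairing a (i (x + y))) = χ (pairing a (i x)) * χ (pairing a (i y)) := by
    intro a x y
    obtain ⟨n, hn⟩ := hunion a
    rw [hpair n a hn, hpair n a hn, hpair n a hn, ← hχadd, ← map_add, ← mul_add]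
    rfl
  have hchar : ∀ a : K, ∫ x, χ (pairing a x) ∂(ν.map i) =
      if Knorm a ≤ 1 then (1 : ℂ) else 0 := by
    intro a
    obtain ⟨n, hn⟩ := hunion a
    rw [integral_map (f := fun x => χ (pairing a x)) hi.measurable.aemeasurable
      (hχcont.comp (hpair_cont a)).aestronglyMeasurable]
    have hle : Knorm a ≤ 1 ↔ ‖a‖ ≤ 1 := by
      rw [hKnorm, pow_le_one_iff_of_nonneg (norm_nonneg _) hd]
    split_ifs with ha <;> rw [hle] at ha
    · have : ∀ x, χ (pairing a (i x)) = 1 := by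
        intro x
        rw [hpair n a hn]
        exact hχtriv _ ((x.2.2 n).2 a hn ha)
      simp [this]
    · obtain ⟨y, hy, hay⟩ := polarBall_exists_one_lt (E := F n) ht hn (not_le.mp ha)
      have hay0 : t (a * y) ≠ 0 := norm_pos_iff.mp (zero_lt_one.trans hay)
      have hc : ‖algebraMap k K (u / t (a * y))‖ ≤ 1 := by
        rw [norm_algebraMap', norm_div]
        exact div_le_one_of_le₀ (humin _ hay) (norm_nonneg _)
      obtain ⟨x, hx, hxy⟩ := exists_polarProj_apply_eq ht hF hTmem hTmul htT hπ
        (polarBall_mul_mem ((F n).algebraMap_mem _) hc hy)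
      refine integral_eq_zero_of_translate ν _ (hadd a) ⟨x, hx⟩ ?_
      have : t (a * (x n : K)) = u := by
        rw [hxy, mul_left_comm, ← Algebra.smul_def, map_smul, smul_eq_mul,
          div_mul_cancel₀ _ hay0]
      rw [hpair n a hn]
      change χ (t (a * (x n : K))) ≠ 1
      rwa [this]
  have hprob : IsProbabilityMeasure (ν.map i) :=
    Measure.isProbabilityMeasure_map hi.measurable.aemeasurable
  refine ⟨ν.map i, ⟨hprob, fun A hA => ?_, hchar⟩, ?_⟩
  · rw [hA.measure_eq_iSup_isCompact_of_ne_top (measure_ne_top _ _)]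
    simp only [iSup_and]
  · rintro P ⟨hP, -, hPchar⟩
    exact huniq P _ hP hprob fun a => (hPchar a).trans (hchar a).symm

end Gaussian

section NormalizedTrace

variable {k K : Type} [Field k] [Field K] [Algebra k K]

theorem trace_relTrace {E F : IntermediateField k K} [FiniteDimensional k F] (h : E ≤ F) (x : F) :
    Algebra.trace k E (relTrace k K E F h x) = Algebra.trace k F x := by
  let _ : Algebra E F := (IntermediateField.inclusion h).toRingHom.toAlgebra
  have _ : IsScalarTower k E F := IsScalarTower.of_algebraMap_eq fun _ => rfl
  have _ : FiniteDimensional E F := FiniteDimensional.right k E F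
  have _ : FiniteDimensional k E := FiniteDimensional.left k E F
  exact Algebra.trace_trace (S := E) x

theorem relTrace_mul {E F : IntermediateField k K} (h : E ≤ F) {a : K} (ha : a ∈ E) (x : F) :
    (relTrace k K E F h (⟨a, h ha⟩ * x) : K) = a * relTrace k K E F h x := by
  let _ : Algebra E F := (IntermediateField.inclusion h).toRingHom.toAlgebra
  have h1 : (⟨a, h ha⟩ * x : F) = (⟨a, ha⟩ : E) • x := rfl
  have h2 := (Algebra.trace E F).map_smul ⟨a, ha⟩ x
  rw [h1]
  exact congrArg Subtype.val h2

theorem normalizedTrace_eq [CharZero k] {E F : IntermediateField k K} [FiniteDimensional k F]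
    (h : E ≤ F) {x : K} (hx : x ∈ E) :
    (finrank k F : k)⁻¹ * Algebra.trace k F ⟨x, h hx⟩ =
      (finrank k E : k)⁻¹ * Algebra.trace k E ⟨x, hx⟩ := by
  let _ : Algebra E F := (IntermediateField.inclusion h).toRingHom.toAlgebra
  have _ : IsScalarTower k E F := IsScalarTower.of_algebraMap_eq fun _ => rfl
  have _ : FiniteDimensional E F := FiniteDimensional.right k E F
  have _ : FiniteDimensional k E := FiniteDimensional.left k E F
  have h1 : (⟨x, h hx⟩ : F) = algebraMap E F ⟨x, hx⟩ := rfl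
  have h2 : (finrank k F : k) = finrank k E * finrank E F := by
    rw [← Nat.cast_mul, finrank_mul_finrank]
  have h3 : (finrank E F : k) ≠ 0 := Nat.cast_ne_zero.mpr finrank_pos.ne'
  have h4 : (finrank k E : k) ≠ 0 := Nat.cast_ne_zero.mpr finrank_pos.ne'
  rw [h1, ← Algebra.trace_trace (S := E), Algebra.trace_algebraMap, map_nsmul, h2, nsmul_eq_mul]
  field_simp

theorem exists_normalizedTrace [CharZero k] (F : ℕ → IntermediateField k K)
    [∀ n, FiniteDimensional k (F n)] (hF : Monotone F) (hunion : ∀ x : K, ∃ n, x ∈ F n) :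
    ∃ t : K →ₗ[k] k, ∀ n x (hx : x ∈ F n),
      t x = (finrank k (F n) : k)⁻¹ * Algebra.trace k (F n) ⟨x, hx⟩ := by
  choose N hN using hunion
  let f : K → k := fun x =>
    (finrank k (F (N x)) : k)⁻¹ * Algebra.trace k (F (N x)) ⟨x, hN x⟩
  have hf : ∀ n x (hx : x ∈ F n),
      f x = (finrank k (F n) : k)⁻¹ * Algebra.trace k (F n) ⟨x, hx⟩ := by
    intro n x hx
    rw [← normalizedTrace_eq (hF (le_max_left n (N x))) hx]
    exact (normalizedTrace_eq (hF (le_max_right n (N x))) (hN x)).symm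
  refine ⟨{ toFun := f, map_add' := fun x y => ?_, map_smul' := fun c x => ?_ }, hf⟩
  · have hx := hF (le_max_left (N x) (N y)) (hN x)
    have hy := hF (le_max_right (N x) (N y)) (hN y)
    rw [hf _ _ hx, hf _ _ hy, hf _ _ (add_mem hx hy), ← mul_add, ← map_add]
    rfl
  · have hx := hN x
    have hcx : c • x ∈ F (N x) := (F (N x)).smul_mem hx
    rw [hf _ _ hx, hf _ _ hcx, RingHom.id_apply, smul_eq_mul, mul_left_comm, ← smul_eq_mul c,
      ← map_smul]
    rfl

end NormalizedTrace

section SpectralNorm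

theorem norm_norm_eq_spectralNorm_pow {k L : Type*} [NontriviallyNormedField k] [CompleteSpace k]
    [IsUltrametricDist k] [Field L] [Algebra k L] [FiniteDimensional k L] (x : L) :
    ‖Algebra.norm k x‖ = spectralNorm k L x ^ finrank k L := by
  have hx : IsIntegral k x := Algebra.IsIntegral.isIntegral x
  have hdeg : (minpoly k x).natDegree ≠ 0 := (minpoly.natDegree_pos hx).ne'
  have h1 : ‖Algebra.norm k (IntermediateField.AdjoinSimple.gen k x)‖ =
      ‖(minpoly k x).coeff 0‖ := by
    have := Algebra.PowerBasis.norm_gen_eq_coeff_zero_minpoly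
      (IntermediateField.adjoin.powerBasis hx)
    rw [IntermediateField.adjoin.powerBasis_gen, IntermediateField.minpoly_gen] at this
    rw [this]
    simp
  rw [Algebra.norm_eq_norm_adjoin, norm_pow, h1, spectralNorm.spectralNorm_eq_norm_coeff_zero_rpow,
    ← finrank_mul_finrank k (IntermediateField.adjoin k {x}) L,
    IntermediateField.adjoin.finrank hx, pow_mul, one_div,
    Real.rpow_inv_natCast_pow (norm_nonneg _) hdeg]

end SpectralNorm

section LocalField

variable {k K : Type} [NontriviallyNormedField k] [NormedField K] [NormedAlgebra k K]

theorem existsUnique_gaussian_of_norm [ProperSpace k] [IsUltrametricDist k] [CharZero k]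
    (p : ℕ) [Fact (Nat.Prime p)] [Algebra ℚ_[p] k] {d : ℕ} (hd : d ≠ 0)
    (habs : ∀ c, absk p k c = ‖c‖ ^ d)
    (Kn : ℕ → IntermediateField k K)
    (hbot : Kn 1 = ⊥) (hmono : Monotone Kn)
    [hfd : ∀ n, FiniteDimensional k (Kn n)]
    (hunion : ∀ x : K, ∃ n, x ∈ Kn n)
    (T : ℕ → K →ₗ[k] K)
    (hTmem : ∀ (n : ℕ) (x : K), T n x ∈ Kn n)
    (hTdef : ∀ (n ν : ℕ) (h : n ≤ ν) (x : K) (hx : x ∈ Kn ν),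
      T n x = ((finrank k (Kn n) : K) / (finrank k (Kn ν) : K)) *
        (relTrace k K (Kn n) (Kn ν) (hmono h) ⟨x, hx⟩ : K))
    (Knorm : K → ℝ) (hKnorm : ∀ x, Knorm x = ‖x‖ ^ d)
    (pairing : K → ProjLim k K Kn T → k)
    (hpair : ∀ (n : ℕ) (a : K) (ha : a ∈ Kn n) (x : ProjLim k K Kn T),
      pairing a x = (finrank k (Kn n) : k)⁻¹ *
        Algebra.trace k (Kn n) (⟨a * x.1 n, mul_mem ha (x.2.1 n)⟩ : Kn n))
    (q : ℕ → ℕ)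
    (hq : ∀ n : ℕ, IsGreatest
      {r : ℝ | (∃ x : Kn n, Knorm ↑x ^ (finrank k (Kn n) : ℝ) = r) ∧ r < 1} ((q n : ℝ)⁻¹))
    (χ : k → ℂ)
    (hχadd : ∀ x y : k, χ (x + y) = χ x * χ y)
    (hχnorm : ∀ x : k, ‖χ x‖ = 1)
    (hχcont : @Continuous _ _ (kTop p k) _ χ)
    (hχtriv : ∀ x : k, absk p k x ≤ 1 → χ x = 1)
    (hχrank : ∃ x : k, absk p k x ≤ (q 1 : ℝ) ∧ χ x ≠ 1) :
    ∃! μ : @Measure (ProjLim k K Kn T) (projMeas k K Kn T Knorm),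
      IsProbabilityMeasure μ ∧
      (∀ A : Set (ProjLim k K Kn T), MeasurableSet[projMeas k K Kn T Knorm] A →
        μ A = ⨆ (C : Set (ProjLim k K Kn T))
          (_ : C ⊆ A ∧ @IsCompact _ (projTop k K Kn T Knorm) C), μ C) ∧
      (∀ a : K, ∫ x, χ (pairing a x) ∂μ = if Knorm a ≤ 1 then (1 : ℂ) else 0) := by
  obtain ⟨t, ht⟩ := exists_normalizedTrace Kn hmono hunion
  have hm : ∀ n, (finrank k (Kn n) : k) ≠ 0 := fun n => Nat.cast_ne_zero.mpr finrank_pos.ne'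
  have ht1 : t 1 = 1 := by
    have h1 : (⟨1, one_mem _⟩ : Kn 0) = algebraMap k (Kn 0) 1 := by rw [map_one]; rfl
    rw [ht 0 1 (one_mem _), h1, Algebra.trace_algebraMap, nsmul_eq_mul, mul_one,
      inv_mul_cancel₀ (hm 0)]
  have hlarge : ∀ n x, ∃ ν, n ≤ ν ∧ x ∈ Kn ν := fun n x => by
    obtain ⟨ν, hν⟩ := hunion x
    exact ⟨max n ν, le_max_left _ _, hmono (le_max_right _ _) hν⟩
  have hTmul : ∀ n, ∀ a ∈ Kn n, ∀ x, T n (a * x) = a * T n x := by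
    intro n a ha x
    obtain ⟨ν, hν, hx⟩ := hlarge n x
    rw [hTdef n ν hν x hx, hTdef n ν hν (a * x) (mul_mem (hmono hν ha) hx), mul_left_comm,
      ← relTrace_mul (hmono hν) ha]
    rfl
  have htT : ∀ n x, t (T n x) = t x := by
    intro n x
    obtain ⟨ν, hν, hx⟩ := hlarge n x
    have h1 : T n x = ((finrank k (Kn n) : k) / (finrank k (Kn ν) : k)) •
        (relTrace k K (Kn n) (Kn ν) (hmono hν) ⟨x, hx⟩ : K) := by
      rw [hTdef n ν hν x hx, Algebra.smul_def, map_div₀, map_natCast, map_natCast]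
    rw [h1, map_smul, ht n _ (relTrace k K (Kn n) (Kn ν) (hmono hν) ⟨x, hx⟩).2, ht ν x hx,
      Subtype.coe_eta, trace_relTrace, smul_eq_mul]
    field_simp [hm n, hm ν]
  have hpow : ∀ n x, Knorm x ^ (finrank k (Kn n) : ℝ) = ‖x‖ ^ (d * finrank k (Kn n)) := by
    intro n x
    rw [Real.rpow_natCast, hKnorm, ← pow_mul]
  have hdm : ∀ n, d * finrank k (Kn n) ≠ 0 := fun n => mul_ne_zero hd finrank_pos.ne'
  have hπ : ∀ n, ∃ π ∈ Kn n, π ≠ 0 ∧ ‖π‖ < 1 ∧ ∀ x ∈ Kn n, ‖x‖ < 1 → ‖x‖ ≤ ‖π‖ := by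
    intro n
    obtain ⟨⟨⟨π, hπq⟩, hlt⟩, hub⟩ := hq n
    have hmax : ∀ x ∈ Kn n, ‖x‖ < 1 → ‖x‖ ≤ ‖(π : K)‖ := by
      intro x hx hx1
      have h1 := hub ⟨⟨⟨x, hx⟩, rfl⟩, by
        rw [hpow]
        exact pow_lt_one₀ (norm_nonneg _) hx1 (hdm n)⟩
      rw [← hπq, hpow, hpow] at h1
      exact (pow_le_pow_iff_left₀ (norm_nonneg _) (norm_nonneg _) (hdm n)).mp h1
    refine ⟨π, π.2, ?_, ?_, hmax⟩
    · obtain ⟨c, hc0, hc1⟩ := NormedField.exists_norm_lt_one k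
      rw [← norm_pos_iff]
      refine hc0.trans_le ?_
      rw [← norm_algebraMap' K c]
      exact hmax _ ((Kn n).algebraMap_mem c) (by rwa [norm_algebraMap'])
    · rw [← hπq, hpow] at hlt
      exact (pow_lt_one_iff_of_nonneg (norm_nonneg _) (hdm n)).mp hlt
  refine existsUnique_gaussian Kn hmono hunion T t ht1 hTmem hTmul htT hπ Knorm hd hKnorm pairing
    ?_ χ hχadd hχnorm ?_ ?_ ?_
  · intro n a ha x
    rw [hpair n a ha, ht n]
  · refine continuous_le_dom ?_ hχcont
    refine le_generateFrom ?_
    rintro U ⟨x, ε, -, rfl⟩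
    simp only [habs]
    exact isOpen_lt (by fun_prop) continuous_const
  · intro x hx
    exact hχtriv x ((habs x).trans_le (pow_le_one₀ (norm_nonneg _) hx))
  · obtain ⟨u, hu, hu1⟩ := hχrank
    refine ⟨u, hu1, fun c hc => ?_⟩
    have hc0 : 0 < ‖c‖ := zero_lt_one.trans hc
    have h1 := (hq 1).2 ⟨⟨⟨algebraMap k K c⁻¹, (Kn 1).algebraMap_mem _⟩, rfl⟩, by
      rw [hpow, norm_algebraMap', norm_inv]
      exact pow_lt_one₀ (by positivity) (inv_lt_one_of_one_lt₀ hc) (hdm 1)⟩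
    have hfin : finrank k (Kn 1) = 1 := by rw [hbot, IntermediateField.finrank_bot]
    rw [hpow, hfin, mul_one, norm_algebraMap', norm_inv, inv_pow] at h1
    rw [habs] at hu
    have hq0 : (0 : ℝ) < (q 1 : ℝ)⁻¹ := (inv_pos.mpr (pow_pos hc0 d)).trans_le h1
    have h2 : (q 1 : ℝ) ≤ ‖c‖ ^ d := (inv_le_inv₀ (pow_pos hc0 d) (inv_pos.mp hq0)).mp h1
    exact (pow_le_pow_iff_left₀ (norm_nonneg _) (norm_nonneg _) hd).mp (hu.trans h2)

end LocalField

theorem statement_6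
    (p : ℕ) [Fact (Nat.Prime p)]
    (k : Type) [Field k] [Algebra ℚ_[p] k] [FiniteDimensional ℚ_[p] k]
    (K : Type) [Field K] [Algebra k K] [CharZero K]
    (Kn : ℕ → IntermediateField k K)
    (hbot : Kn 1 = ⊥) (hmono : Monotone Kn)
    [hfd : ∀ n, FiniteDimensional k (Kn n)]
    (hunion : ∀ x : K, ∃ n, x ∈ Kn n)
    (T : ℕ → K →ₗ[k] K)
    (hTmem : ∀ (n : ℕ) (x : K), T n x ∈ Kn n)
    (hTdef : ∀ (n ν : ℕ) (h : n ≤ ν) (x : K) (hx : x ∈ Kn ν),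
      T n x = ((finrank k (Kn n) : K) / (finrank k (Kn ν) : K)) *
        (relTrace k K (Kn n) (Kn ν) (hmono h) ⟨x, hx⟩ : K))
    (Knorm : K → ℝ)
    (hKnorm : ∀ (n : ℕ) (x : K) (hx : x ∈ Kn n),
      Knorm x = absk p k (Algebra.norm k (⟨x, hx⟩ : Kn n)) ^ ((finrank k (Kn n) : ℝ)⁻¹))
    (pairing : K → ProjLim k K Kn T → k)
    (hpair : ∀ (n : ℕ) (a : K) (ha : a ∈ Kn n) (x : ProjLim k K Kn T),
      pairing a x = (finrank k (Kn n) : k)⁻¹ *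
        Algebra.trace k (Kn n) (⟨a * x.1 n, mul_mem ha (x.2.1 n)⟩ : Kn n))
    (q : ℕ → ℕ)
    (hq : ∀ n : ℕ, IsGreatest
      {r : ℝ | (∃ x : Kn n, Knorm ↑x ^ (finrank k (Kn n) : ℝ) = r) ∧ r < 1} ((q n : ℝ)⁻¹))
    (χ : k → ℂ)
    (hχadd : ∀ x y : k, χ (x + y) = χ x * χ y)
    (hχnorm : ∀ x : k, ‖χ x‖ = 1)
    (hχcont : @Continuous _ _ (kTop p k) _ χ)
    (hχtriv : ∀ x : k, absk p k x ≤ 1 → χ x = 1)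
    (hχrank : ∃ x : k, absk p k x ≤ (q 1 : ℝ) ∧ χ x ≠ 1)
    :
    ∃! μ : @MeasureTheory.Measure (ProjLim k K Kn T) (projMeas k K Kn T Knorm),
      MeasureTheory.IsProbabilityMeasure μ ∧
      (∀ A : Set (ProjLim k K Kn T), MeasurableSet[projMeas k K Kn T Knorm] A →
        μ A = ⨆ (C : Set (ProjLim k K Kn T))
          (_ : C ⊆ A ∧ @IsCompact _ (projTop k K Kn T Knorm) C), μ C) ∧
      (∀ a : K, ∫ x, χ (pairing a x) ∂μ = if Knorm a ≤ 1 then (1 : ℂ) else 0) := by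
  let _ : Algebra ℚ_[p] K := ((algebraMap k K).comp (algebraMap ℚ_[p] k)).toAlgebra
  have _ : IsScalarTower ℚ_[p] k K := IsScalarTower.of_algebraMap_eq fun _ => rfl
  have _ : Algebra.IsAlgebraic k K := ⟨fun x => by
    obtain ⟨n, hn⟩ := hunion x
    exact IntermediateField.isAlgebraic_iff.mp (Algebra.IsAlgebraic.isAlgebraic (⟨x, hn⟩ : Kn n))⟩
  have _ : Algebra.IsAlgebraic ℚ_[p] K := Algebra.IsAlgebraic.trans ℚ_[p] k K
  have _ : CharZero k := charZero_of_injective_algebraMap (algebraMap ℚ_[p] k).injective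
  have hd : finrank ℚ_[p] k ≠ 0 := finrank_pos.ne'
  have habs : ∀ c, absk p k c = spectralNorm ℚ_[p] k c ^ finrank ℚ_[p] k :=
    fun c => norm_norm_eq_spectralNorm_pow c
  have hKn : ∀ x, Knorm x = spectralNorm ℚ_[p] K x ^ finrank ℚ_[p] k := by
    intro x
    obtain ⟨n, hn⟩ := hunion x
    have _ : FiniteDimensional ℚ_[p] (Kn n) := FiniteDimensional.trans ℚ_[p] k (Kn n)
    have _ : IsScalarTower ℚ_[p] (Kn n) K := IsScalarTower.of_algebraMap_eq fun _ => rfl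
    have hm : finrank k (Kn n) ≠ 0 := finrank_pos.ne'
    rw [hKnorm n x hn, absk, Algebra.norm_norm, norm_norm_eq_spectralNorm_pow,
      ← finrank_mul_finrank ℚ_[p] k (Kn n), pow_mul,
      Real.pow_rpow_inv_natCast (pow_nonneg (spectralNorm_nonneg _) _) hm,
      spectralNorm.eq_of_tower (K := ℚ_[p]) (L := K) (⟨x, hn⟩ : Kn n)]
    rfl
  let _ : NontriviallyNormedField k := spectralNorm.nontriviallyNormedField ℚ_[p] k
  let _ : NormedField K := spectralNorm.normedField ℚ_[p] K
  let _ : NormedAlgebra ℚ_[p] k := spectralNorm.normedAlgebra ℚ_[p] k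
  let _ : NormedAlgebra k K := spectralNorm.normedAlgebra' ℚ_[p] k K
  have _ : ProperSpace k := FiniteDimensional.proper ℚ_[p] k
  have _ : IsUltrametricDist k :=
    IsUltrametricDist.isUltrametricDist_of_isNonarchimedean_norm
      (isNonarchimedean_spectralNorm (K := ℚ_[p]) (L := k))
  exact existsUnique_gaussian_of_norm p hd habs Kn hbot hmono hunion T hTmem hTdef Knorm hKn
    pairing hpair q hq χ hχadd hχnorm hχcont hχtriv hχrank
end
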